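/- Let q ≥ 2 be an integer and β > q, let 𝒱 = {V₁,…,V_q} be a λ-partition of V with constant λ ∈ (0,1), and for r > 0 and a pair of configurations (x, y) ∈ Ω × Ω let P(r) denote the event that ‖α(x) − m‖_∞ ≤ r/√n, ‖α(y) − m‖_∞ ≤ r/√n, max_{k∈[q]} |α₁(x) − α_{1,k}(x)| ≤ r/√n, and max_{k∈[q]} |α₁(y) − α_{1,k}(y)| ≤ r/√n. Then for any δ ∈ (0,1) there exists r = r(δ) > 0 such that for all sufficiently large n and every pair (x, y) satisfying P(r): if X′ and Y′ are obtained from x and y respectively by independent single SW steps, then (X′, Y′) satisfies P(r) with probability at least δ. -/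

import Mathlib

open scoped Classical
open Finset

/-- Spin configurations on `n` vertices with `q` spins. -/
abbrev Conf (n q : ℕ) := Fin n → Fin q

/-- Number of vertices assigned spin `j`. -/
def cntN {n q : ℕ} (X : Conf n q) (j : Fin q) : ℕ :=
  (Finset.univ.filter (fun v => X v = j)).card

/-- Number of monochromatic pairs `{u,v}` (`u < v`, same spin). -/
def numMono {n q : ℕ} (σ : Conf n q) : ℕ :=
  (Finset.univ.filter (fun p : Fin n × Fin n => p.1 < p.2 ∧ σ p.1 = σ p.2)).card

/-- The mean-field `q`-state Potts measure: probability of `σ`. -/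
noncomputable def pottsProb (n q : ℕ) (β : ℝ) (σ : Conf n q) : ℝ :=
  Real.exp (β / n * numMono σ) / ∑ τ : Conf n q, Real.exp (β / n * numMono τ)

/-- The set of monochromatic pairs of a configuration. -/
def monoPairs {n q : ℕ} (σ : Conf n q) : Finset (Fin n × Fin n) :=
  Finset.univ.filter (fun p : Fin n × Fin n => p.1 < p.2 ∧ σ p.1 = σ p.2)

/-- The graph on `Fin n` whose edges are the pairs in `E`. -/
def graphOf {n : ℕ} (E : Finset (Fin n × Fin n)) : SimpleGraph (Fin n) :=
  SimpleGraph.fromRel (fun u v => (u, v) ∈ E)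

/-- Number of connected components of the graph `(V, E)`. -/
noncomputable def numComps {n : ℕ} (E : Finset (Fin n × Fin n)) : ℕ :=
  Nat.card (graphOf E).ConnectedComponent

/-- One-step transition probability of the Swendsen–Wang dynamics:
percolate on monochromatic pairs with probability `p = 1 - exp (-β/n)`,
then color each connected component uniformly at random. -/
noncomputable def swStep (n q : ℕ) (β : ℝ) (σ τ : Conf n q) : ℝ :=
  ∑ E ∈ (monoPairs σ).powerset,
    ((1 - Real.exp (-(β / n))) ^ E.card *
        Real.exp (-(β / n)) ^ ((monoPairs σ).card - E.card)) *
      (if ∀ u v : Fin n, (graphOf E).Reachable u v → τ u = τ v then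
        ((q : ℝ))⁻¹ ^ numComps E else 0)

/-- `t`-step transition probability of the Swendsen–Wang dynamics. -/
noncomputable def swProb (n q : ℕ) (β : ℝ) : ℕ → Conf n q → Conf n q → ℝ
  | 0, σ, τ => if σ = τ then 1 else 0
  | t + 1, σ, τ => ∑ η : Conf n q, swStep n q β σ η * swProb n q β t η τ

/-- Probability of observing the trajectory `ω 0, ω 1, …, ω (ℓ-1)` at times
`1, …, ℓ` for the SW dynamics started at `X₀`. -/
noncomputable def pathProb (n q : ℕ) (β : ℝ) (X₀ : Conf n q) (ℓ : ℕ)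
    (ω : Fin ℓ → Conf n q) : ℝ :=
  ∏ i : Fin ℓ, swStep n q β
    (if _h : 0 < (i : ℕ) then
        ω ⟨(i : ℕ) - 1, lt_of_le_of_lt (Nat.sub_le _ _) i.isLt⟩
      else X₀) (ω i)

/-- Total variation distance between two probability vectors on configurations. -/
noncomputable def tvDist {n q : ℕ} (f g : Conf n q → ℝ) : ℝ :=
  (∑ τ : Conf n q, |f τ - g τ|) / 2

/-- Mixing time `τ_mix(ε)` of the SW dynamics. -/
noncomputable def mixingTime (n q : ℕ) (β ε : ℝ) : ℕ :=
  sInf {t : ℕ | ∀ σ : Conf n q, tvDist (swProb n q β t σ) (pottsProb n q β) ≤ ε}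

/-- `theta lam` is the unique root in `(0,1)` of `exp (-lam * x) = 1 - x`
for `lam > 1`, and `0` for `lam ≤ 1`. -/
noncomputable def theta (lam : ℝ) : ℝ :=
  if lam ≤ 1 then 0
  else sSup {x : ℝ | x ∈ Set.Ioo (0 : ℝ) 1 ∧ Real.exp (-lam * x) = 1 - x}

/-- The drift function `F`. -/
noncomputable def F (q : ℕ) (β : ℝ) (x : ℝ) : ℝ :=
  1 / q + (1 - 1 / q) * theta (β * x) * x

/-- The unique fixed point of `F` in `(1/q, 1]` (for `β > q`). -/
noncomputable def aFix (q : ℕ) (β : ℝ) : ℝ :=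
  sSup {x : ℝ | x ∈ Set.Ioc (1 / (q : ℝ)) 1 ∧ F q β x = x}

/-- The cutoff constant `c(β,q) = (2 log (1 / F'(a)))⁻¹`. -/
noncomputable def cConst (q : ℕ) (β : ℝ) : ℝ :=
  (2 * Real.log (1 / deriv (F q β) (aFix q β)))⁻¹

/-- Fraction of vertices assigned spin `j`. -/
noncomputable def cntFrac {n q : ℕ} (X : Conf n q) : Fin q → ℝ :=
  fun j => (cntN X j : ℝ) / n

/-- The proportions vector `α(X)`: fractions of vertices of each spin,
sorted in nonincreasing order. -/
noncomputable def alphaVec {n q : ℕ} (X : Conf n q) : Fin q → ℝ :=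
  fun i => cntFrac X (Tuple.sort (cntFrac X) i.rev)

/-- `ℓ∞` distance between two vectors indexed by `Fin q`. -/
noncomputable def linf {q : ℕ} (f g : Fin q → ℝ) : ℝ :=
  ⨆ i : Fin q, |f i - g i|

/-- The vector `κ(b) = (b, (1-b)/(q-1), …, (1-b)/(q-1))`. -/
noncomputable def kappaVec (q : ℕ) (b : ℝ) : Fin q → ℝ :=
  fun i => if (i : ℕ) = 0 then b else (1 - b) / ((q : ℝ) - 1)

/-- The majority vector `m = (a, (1-a)/(q-1), …, (1-a)/(q-1))`. -/
noncomputable def mVec (q : ℕ) (β : ℝ) : Fin q → ℝ :=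
  kappaVec q (aFix q β)

/-- Index of the most common spin of `X` (least such index on ties). -/
noncomputable def domIdx {n q : ℕ} (X : Conf n q) : ℕ :=
  sInf {j : ℕ | ∃ hj : j < q, ∀ j' : Fin q, cntN X j' ≤ cntN X ⟨j, hj⟩}

/-- `α₁(X)`: fraction of vertices carrying the most common spin of `X`. -/
noncomputable def alpha1 {n q : ℕ} (X : Conf n q) : ℝ :=
  ((Finset.univ.filter (fun v : Fin n => (X v : ℕ) = domIdx X)).card : ℝ) / n

/-- `α_{1,k}(X)`: fraction of vertices of `Vk` carrying the most common spin of `X`. -/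
noncomputable def alpha1In {n q : ℕ} (X : Conf n q) (Vk : Finset (Fin n)) : ℝ :=
  ((Vk.filter (fun v => (X v : ℕ) = domIdx X)).card : ℝ) / Vk.card

/-- `P` is a partition of the vertex set into `q` classes. -/
def IsPartition {n q : ℕ} (P : Fin q → Finset (Fin n)) : Prop :=
  (∀ i j, i ≠ j → Disjoint (P i) (P j)) ∧ ∀ v : Fin n, ∃ i, v ∈ P i

/-- A `λ`-partition: a partition with all classes of size at least `λ n`. -/
def IsLamPartition {n q : ℕ} (lam : ℝ) (P : Fin q → Finset (Fin n)) : Prop :=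
  IsPartition P ∧ ∀ i, lam * n ≤ ((P i).card : ℝ)

/-- Projection: `projCnt P X i j` is the number of vertices of `P i`
assigned spin `j` in `X`. -/
def projCnt {n q : ℕ} (P : Fin q → Finset (Fin n)) (X : Conf n q) :
    Fin q → Fin q → ℕ :=
  fun i j => ((P i).filter (fun v => X v = j)).card

/-- All potential edges of the complete graph on `Fin n`. -/
def allPairs (n : ℕ) : Finset (Fin n × Fin n) :=
  Finset.univ.filter (fun p : Fin n × Fin n => p.1 < p.2)

/-- Probability of the edge set `E` under the Erdős–Rényi measure `G(n,p)`. -/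
noncomputable def erProb (n : ℕ) (p : ℝ) (E : Finset (Fin n × Fin n)) : ℝ :=
  p ^ E.card * (1 - p) ^ ((allPairs n).card - E.card)

/-- Size of the connected component of `v` in the graph `(V, E)`. -/
noncomputable def compCard {n : ℕ} (E : Finset (Fin n × Fin n)) (v : Fin n) : ℕ :=
  (Finset.univ.filter (fun u => (graphOf E).Reachable v u)).card

/-- `L₁`: size of the largest connected component. -/
noncomputable def L1 {n : ℕ} (E : Finset (Fin n × Fin n)) : ℕ :=
  Finset.univ.sup (fun v => compCard E v)

/-- Sum of the squares of the component sizes, `Σ_j L_j²`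
(computed as `Σ_v |C(v)|`). -/
noncomputable def sumCompSq {n : ℕ} (E : Finset (Fin n × Fin n)) : ℕ :=
  ∑ v : Fin n, compCard E v

/-- Expectation of `f` under the Erdős–Rényi measure `G(n,p)`. -/
noncomputable def erExp (n : ℕ) (p : ℝ) (f : Finset (Fin n × Fin n) → ℝ) : ℝ :=
  ∑ E ∈ (allPairs n).powerset, erProb n p E * f E

/-- Random-cluster weight of an edge set with parameters `q`, `p = 1 - exp (-β/n)`. -/
noncomputable def rcWeight (n q : ℕ) (β : ℝ) (E : Finset (Fin n × Fin n)) : ℝ :=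
  (1 - Real.exp (-(β / n))) ^ E.card *
    Real.exp (-(β / n)) ^ ((allPairs n).card - E.card) * (q : ℝ) ^ numComps E

/-- The mean-field random-cluster measure: probability of the edge set `E`. -/
noncomputable def rcProb (n q : ℕ) (β : ℝ) (E : Finset (Fin n × Fin n)) : ℝ :=
  rcWeight n q β E / ∑ B ∈ (allPairs n).powerset, rcWeight n q β B

section BernoulliExpectation

variable {ι κ : Type*} {p : ℝ} {D : Finset ι}

/-- Expectation of `f` at the random subset of `D` that keeps each element independently
with probability `p`. -/
noncomputable def bernE (p : ℝ) (D : Finset ι) (f : Finset ι → ℝ) : ℝ :=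
  ∑ E ∈ D.powerset, p ^ E.card * (1 - p) ^ (D.card - E.card) * f E

/-- Probability of the event `B` under the measure underlying `bernE`. -/
noncomputable def bernP (p : ℝ) (D : Finset ι) (B : Finset ι → Prop) : ℝ :=
  bernE p D (fun E => if B E then 1 else 0)

lemma bernE_empty (f : Finset ι → ℝ) : bernE p ∅ f = f ∅ := by
  simp [bernE]

lemma bernE_insert [DecidableEq ι] {a : ι} (ha : a ∉ D) (f : Finset ι → ℝ) :
    bernE p (insert a D) f =
      p * bernE p D (fun E => f (insert a E)) + (1 - p) * bernE p D f := by
  unfold bernE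
  rw [Finset.sum_powerset_insert ha, add_comm, Finset.mul_sum, Finset.mul_sum]
  congr 1
  · refine Finset.sum_congr rfl fun E hE => ?_
    have hE' := Finset.mem_powerset.1 hE
    rw [Finset.card_insert_of_notMem ha, Finset.card_insert_of_notMem (fun h => ha (hE' h)),
      Nat.add_sub_add_right, pow_succ]
    ring
  · refine Finset.sum_congr rfl fun E hE => ?_
    have hc := Finset.card_le_card (Finset.mem_powerset.1 hE)
    rw [Finset.card_insert_of_notMem ha, Nat.sub_add_comm hc, pow_succ]
    ring

lemma bernE_congr {f g : Finset ι → ℝ} (h : ∀ E ⊆ D, f E = g E) :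
    bernE p D f = bernE p D g :=
  Finset.sum_congr rfl fun E hE => by rw [h E (Finset.mem_powerset.1 hE)]

lemma bernE_mono (h0 : 0 ≤ p) (h1 : p ≤ 1) {f g : Finset ι → ℝ} (h : ∀ E ⊆ D, f E ≤ g E) :
    bernE p D f ≤ bernE p D g :=
  Finset.sum_le_sum fun E hE => mul_le_mul_of_nonneg_left (h E (Finset.mem_powerset.1 hE))
    (mul_nonneg (pow_nonneg h0 _) (pow_nonneg (sub_nonneg.2 h1) _))

lemma bernE_const (c : ℝ) : bernE p D (fun _ => c) = c := by
  induction D using Finset.induction_on with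
  | empty => exact bernE_empty _
  | insert a D ha ih => rw [bernE_insert ha, ih]; ring

lemma bernE_add (f g : Finset ι → ℝ) :
    bernE p D (fun E => f E + g E) = bernE p D f + bernE p D g := by
  simp only [bernE, mul_add, Finset.sum_add_distrib]

lemma bernE_const_mul (c : ℝ) (f : Finset ι → ℝ) :
    bernE p D (fun E => c * f E) = c * bernE p D f := by
  simp only [bernE, Finset.mul_sum]
  exact Finset.sum_congr rfl fun _ _ => by ring

lemma bernE_sum {α : Type*} (s : Finset α) (f : α → Finset ι → ℝ) :
    bernE p D (fun E => ∑ i ∈ s, f i E) = ∑ i ∈ s, bernE p D (f i) := by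
  simp only [bernE, Finset.mul_sum]
  exact Finset.sum_comm

lemma bernE_union [DecidableEq ι] {D' : Finset ι} (hD : Disjoint D D') (f : Finset ι → ℝ) :
    bernE p (D ∪ D') f = bernE p D (fun E => bernE p D' (fun E' => f (E ∪ E'))) := by
  induction D using Finset.induction_on generalizing f with
  | empty => simp [bernE_empty]
  | insert a D ha ih =>
    rw [Finset.disjoint_insert_left] at hD
    rw [Finset.insert_union, bernE_insert (by simp [ha, hD.1]), bernE_insert ha, ih hD.2, ih hD.2]
    simp only [Finset.insert_union]

lemma bernE_map (e : ι ↪ κ) (f : Finset κ → ℝ) :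
    bernE p (D.map e) f = bernE p D (fun E => f (E.map e)) := by
  induction D using Finset.induction_on generalizing f with
  | empty => simp [bernE_empty]
  | insert a D ha ih =>
    rw [Finset.map_insert, bernE_insert (by simpa using ha), bernE_insert ha, ih, ih]
    simp only [Finset.map_insert]

lemma bernE_inter [DecidableEq ι] {D' : Finset ι} (hD : D' ⊆ D) (f : Finset ι → ℝ) :
    bernE p D (fun E => f (E ∩ D')) = bernE p D' f := by
  conv_lhs => rw [← Finset.union_sdiff_of_subset hD]
  rw [bernE_union Finset.disjoint_sdiff]
  refine bernE_congr fun E hE => ?_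
  rw [← bernE_const (p := p) (D := D \ D') (f E)]
  refine bernE_congr fun E' hE' => ?_
  congr 1
  ext x
  have h1 := @hE x
  have h2 := @hE' x
  simp only [Finset.mem_sdiff] at h2
  simp only [Finset.mem_inter, Finset.mem_union]
  tauto

lemma bernE_card : bernE p D (fun E => (E.card : ℝ)) = p * D.card := by
  induction D using Finset.induction_on with
  | empty => simp [bernE_empty]
  | insert a D ha ih =>
    have : bernE p D (fun E => ((insert a E).card : ℝ)) = bernE p D (fun E => (E.card : ℝ) + 1) :=
      bernE_congr fun E hE => by
        rw [Finset.card_insert_of_notMem (fun h => ha (hE h))]; push_cast; ring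
    rw [bernE_insert ha, this, bernE_add, bernE_const, ih, Finset.card_insert_of_notMem ha]
    push_cast; ring

lemma bernE_sq_card_sdiff_self [DecidableEq ι] (c : ℝ) :
    bernE p D (fun E => (((D \ E).card : ℝ) - c) ^ 2) =
      ((1 - p) * D.card - c) ^ 2 + D.card * (p * (1 - p)) := by
  induction D using Finset.induction_on generalizing c with
  | empty => simp [bernE_empty]
  | insert a D ha ih =>
    have h1 : bernE p D (fun E => (((insert a D \ insert a E).card : ℝ) - c) ^ 2) =
        bernE p D (fun E => (((D \ E).card : ℝ) - c) ^ 2) :=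
      bernE_congr fun E hE => by
        rw [Finset.insert_sdiff_insert, Finset.sdiff_insert_of_notMem ha]
    have h2 : bernE p D (fun E => (((insert a D \ E).card : ℝ) - c) ^ 2) =
        bernE p D (fun E => (((D \ E).card : ℝ) - (c - 1)) ^ 2) :=
      bernE_congr fun E hE => by
        rw [Finset.insert_sdiff_of_notMem _ (fun h => ha (hE h)),
          Finset.card_insert_of_notMem (by simp [ha])]
        push_cast; ring
    rw [bernE_insert ha, h1, h2, ih, ih, Finset.card_insert_of_notMem ha]
    push_cast; ring

lemma bernE_sq_card_sdiff [DecidableEq ι] {A : Finset ι} (hA : A ⊆ D) (c : ℝ) :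
    bernE p D (fun E => (((A \ E).card : ℝ) - c) ^ 2) =
      ((1 - p) * A.card - c) ^ 2 + A.card * (p * (1 - p)) := by
  rw [← bernE_sq_card_sdiff_self, ← bernE_inter hA]
  simp only [Finset.inter_comm _ A, Finset.sdiff_inter_self_left]

lemma bernP_mono (h0 : 0 ≤ p) (h1 : p ≤ 1) {B C : Finset ι → Prop}
    (h : ∀ E ⊆ D, B E → C E) : bernP p D B ≤ bernP p D C := by
  refine bernE_mono h0 h1 fun E hE => ?_
  by_cases hB : B E
  · simp [hB, h E hE hB]
  · split_ifs <;> simp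

lemma bernP_or_le (h0 : 0 ≤ p) (h1 : p ≤ 1) (B C : Finset ι → Prop) :
    bernP p D (fun E => B E ∨ C E) ≤ bernP p D B + bernP p D C := by
  unfold bernP
  rw [← bernE_add]
  refine bernE_mono h0 h1 fun E _ => ?_
  by_cases hB : B E <;> by_cases hC : C E <;> simp [hB, hC]

/-- Markov's inequality. -/
lemma mul_bernP_le (h0 : 0 ≤ p) (h1 : p ≤ 1) {B : Finset ι → Prop} {f : Finset ι → ℝ} {b : ℝ}
    (hf : ∀ E ⊆ D, 0 ≤ f E) (h : ∀ E ⊆ D, B E → b ≤ f E) :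
    b * bernP p D B ≤ bernE p D f := by
  unfold bernP
  rw [← bernE_const_mul]
  refine bernE_mono h0 h1 fun E hE => ?_
  split_ifs with hB
  · simpa using h E hE hB
  · simpa using hf E hE

/-- Markov's inequality, as a bound on the probability. -/
lemma bernP_le_of_bernE_le (h0 : 0 ≤ p) (h1 : p ≤ 1) {B : Finset ι → Prop}
    {f : Finset ι → ℝ} {b e ε : ℝ} (hb : 0 < b) (hf : ∀ E ⊆ D, 0 ≤ f E)
    (h : ∀ E ⊆ D, B E → b ≤ f E) (he : bernE p D f ≤ e) (hε : e ≤ ε * b) :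
    bernP p D B ≤ ε := by
  have := mul_bernP_le h0 h1 hf h
  nlinarith

lemma bernP_exists_le (h0 : 0 ≤ p) (h1 : p ≤ 1) {α : Type*} (s : Finset α)
    (B : α → Finset ι → Prop) :
    bernP p D (fun E => ∃ i ∈ s, B i E) ≤ ∑ i ∈ s, bernP p D (B i) := by
  unfold bernP
  rw [← bernE_sum]
  refine bernE_mono h0 h1 fun E _ => ?_
  have h : ∀ i ∈ s, (0 : ℝ) ≤ if B i E then 1 else 0 := fun i _ => by split_ifs <;> norm_num
  split_ifs with hB
  · obtain ⟨i, hi, hBi⟩ := hB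
    refine le_trans ?_ (Finset.single_le_sum h hi)
    simp [hBi]
  · exact Finset.sum_nonneg h

end BernoulliExpectation

section Clusters

variable {n : ℕ} {E E' : Finset (Fin n × Fin n)} {S M R A N : Finset (Fin n)} {u v w : Fin n}

/-- The ordered pairs with both endpoints in `S`. -/
noncomputable def pairsIn (S : Finset (Fin n)) : Finset (Fin n × Fin n) :=
  Finset.univ.filter (fun e => e.1 < e.2 ∧ e.1 ∈ S ∧ e.2 ∈ S)

/-- The vertices connected to `M` in the graph `(V, E)`. -/
noncomputable def cluster (E : Finset (Fin n × Fin n)) (M : Finset (Fin n)) : Finset (Fin n) :=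
  Finset.univ.filter (fun w => ∃ u ∈ M, (graphOf E).Reachable u w)

/-- The ordered pair formed by `v` and `w`. -/
def starPair (v : Fin n) : Fin n ↪ Fin n × Fin n where
  toFun w := if v < w then (v, w) else (w, v)
  inj' a b h := by
    dsimp only at h
    split_ifs at h <;> simp_all

lemma starPair_apply : starPair v w = if v < w then (v, w) else (w, v) := rfl

lemma mem_pairsIn {e : Fin n × Fin n} :
    e ∈ pairsIn S ↔ e.1 < e.2 ∧ e.1 ∈ S ∧ e.2 ∈ S := by
  simp [pairsIn]

lemma pairsIn_mono (h : R ⊆ S) : pairsIn R ⊆ pairsIn S := fun _ he => by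
  rw [mem_pairsIn] at he ⊢
  exact ⟨he.1, h he.2.1, h he.2.2⟩

lemma mem_cluster : w ∈ cluster E M ↔ ∃ u ∈ M, (graphOf E).Reachable u w := by
  simp [cluster]

lemma mem_cluster_singleton : w ∈ cluster E {v} ↔ (graphOf E).Reachable v w := by
  simp [cluster]

lemma subset_cluster : M ⊆ cluster E M := fun u hu => mem_cluster.2 ⟨u, hu, .refl _⟩

lemma cluster_empty : cluster E ∅ = ∅ := by
  ext; simp [mem_cluster]

lemma graphOf_adj : (graphOf E).Adj u v ↔ u ≠ v ∧ ((u, v) ∈ E ∨ (v, u) ∈ E) := by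
  simp [graphOf]

lemma graphOf_mono (h : E' ⊆ E) : graphOf E' ≤ graphOf E := fun u v huv => by
  rw [graphOf_adj] at huv ⊢
  exact ⟨huv.1, huv.2.imp (@h _) (@h _)⟩

lemma mem_of_reachable (hR : ∀ u w, u ∈ R → (graphOf E).Adj u w → w ∈ R) (hu : u ∈ R)
    (h : (graphOf E).Reachable u w) : w ∈ R := by
  obtain ⟨p⟩ := h
  induction p with
  | nil => exact hu
  | cons hadj _ ih => exact ih (hR _ _ hu hadj)

lemma cluster_subset (hM : M ⊆ R) (hR : ∀ u w, u ∈ R → (graphOf E).Adj u w → w ∈ R) :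
    cluster E M ⊆ R := fun w hw => by
  obtain ⟨u, hu, h⟩ := mem_cluster.1 hw
  exact mem_of_reachable hR (hM hu) h

lemma mem_cluster_of_adj (hu : u ∈ cluster E M) (h : (graphOf E).Adj u w) :
    w ∈ cluster E M := by
  obtain ⟨x, hx, hxu⟩ := mem_cluster.1 hu
  exact mem_cluster.2 ⟨x, hx, hxu.trans h.reachable⟩

lemma mem_of_adj_pairsIn (hE : E ⊆ pairsIn S) (h : (graphOf E).Adj u w) : u ∈ S ∧ w ∈ S := by
  rcases (graphOf_adj.1 h).2 with h | h <;> have := mem_pairsIn.1 (hE h) <;> tauto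

lemma cluster_subset_of_pairsIn (hE : E ⊆ pairsIn S) (hM : M ⊆ S) : cluster E M ⊆ S :=
  cluster_subset hM fun _ _ _ h => (mem_of_adj_pairsIn hE h).2

lemma cluster_mono (hE : E' ⊆ E) (hM : N ⊆ M) : cluster E' N ⊆ cluster E M := fun w hw => by
  obtain ⟨u, hu, h⟩ := mem_cluster.1 hw
  exact mem_cluster.2 ⟨u, hM hu, h.mono (graphOf_mono hE)⟩

lemma cluster_singleton_eq (h : w ∈ cluster E {v}) : cluster E {w} = cluster E {v} := by
  rw [mem_cluster_singleton] at h
  ext x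
  rw [mem_cluster_singleton, mem_cluster_singleton]
  exact ⟨h.trans, h.symm.trans⟩

lemma cluster_eq_biUnion : cluster E M = M.biUnion (fun v => cluster E {v}) := by
  ext; simp [mem_cluster]

/-- If no edge leaves `R`, the clusters inside `R` are determined by the edges inside `R`. -/
lemma cluster_inter_pairsIn (hE : ∀ e ∈ E, e.1 < e.2)
    (hR : ∀ u w, u ∈ R → (graphOf E).Adj u w → w ∈ R) (hM : M ⊆ R) :
    cluster (E ∩ pairsIn R) M = cluster E M := by
  refine (cluster_mono Finset.inter_subset_left subset_rfl).antisymm ?_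
  have : cluster E M ⊆ R ∩ cluster (E ∩ pairsIn R) M := by
    refine cluster_subset (Finset.subset_inter hM subset_cluster) fun u w hu h => ?_
    rw [Finset.mem_inter] at hu ⊢
    have hw := hR u w hu.1 h
    refine ⟨hw, mem_cluster_of_adj hu.2 ?_⟩
    rw [graphOf_adj] at h ⊢
    refine ⟨h.1, h.2.imp (fun h => ?_) (fun h => ?_)⟩ <;>
      simp only [Finset.mem_inter, mem_pairsIn]
    exacts [⟨h, hE _ h, hu.1, hw⟩, ⟨h, hE _ h, hw, hu.1⟩]
  exact this.trans Finset.inter_subset_right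

lemma starPair_mem_iff {N : Finset (Fin n)} (hw : w ≠ v) :
    ((v, w) ∈ N.map (starPair v) ∨ (w, v) ∈ N.map (starPair v)) ↔ w ∈ N := by
  simp only [Finset.mem_map, starPair_apply]
  constructor
  · rintro (⟨a, ha, h⟩ | ⟨a, ha, h⟩) <;> split_ifs at h <;> simp_all
  · intro h
    by_cases hvw : v < w
    · exact Or.inl ⟨w, h, by simp [hvw]⟩
    · exact Or.inr ⟨w, h, by simp [hvw]⟩

lemma eq_or_eq_of_mem_map_starPair {e : Fin n × Fin n} (h : e ∈ N.map (starPair v)) :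
    e.1 = v ∨ e.2 = v := by
  simp only [Finset.mem_map, starPair_apply] at h
  obtain ⟨a, _, rfl⟩ := h
  split_ifs <;> simp

lemma disjoint_map_starPair :
    Disjoint ((S.erase v).map (starPair v)) (pairsIn (S.erase v)) := by
  rw [Finset.disjoint_left]
  intro e he h
  rw [mem_pairsIn] at h
  rcases eq_or_eq_of_mem_map_starPair he with h' | h' <;> simp [h'] at h

lemma pairsIn_eq_union (hv : v ∈ S) :
    pairsIn S = (S.erase v).map (starPair v) ∪ pairsIn (S.erase v) := by
  ext ⟨a, b⟩
  simp only [mem_pairsIn, Finset.mem_union, Finset.mem_map, starPair_apply,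
    Finset.mem_erase]
  constructor
  · rintro ⟨hab, ha, hb⟩
    by_cases h1 : a = v
    · subst h1
      exact Or.inl ⟨b, ⟨hab.ne', hb⟩, by simp [hab]⟩
    by_cases h2 : b = v
    · subst h2
      exact Or.inl ⟨a, ⟨hab.ne, ha⟩, by simp [hab.not_gt]⟩
    exact Or.inr ⟨hab, ⟨h1, ha⟩, h2, hb⟩
  · rintro (⟨c, ⟨hc, hcS⟩, h⟩ | ⟨hab, ha, hb⟩)
    · split_ifs at h with hvc <;> obtain ⟨rfl, rfl⟩ := Prod.mk.inj h
      · exact ⟨hvc, hv, hcS⟩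
      · exact ⟨lt_of_le_of_ne (not_lt.1 hvc) hc, hcS, hv⟩
    · exact ⟨hab, ha.2, hb.2⟩

/-- Revealing the neighbours of `v` first. -/
lemma bernE_pairsIn (p : ℝ) (hv : v ∈ S) (f : Finset (Fin n × Fin n) → ℝ) :
    bernE p (pairsIn S) f = bernE p (S.erase v) (fun N =>
      bernE p (pairsIn (S.erase v)) (fun E => f (N.map (starPair v) ∪ E))) := by
  rw [pairsIn_eq_union hv, bernE_union disjoint_map_starPair, bernE_map]

/-- One step of the exploration of the cluster of `M`. -/
lemma cluster_explore (hE : E ⊆ pairsIn (S.erase v)) (hv : v ∈ M) (hN : v ∉ N) :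
    cluster (N.map (starPair v) ∪ E) M = insert v (cluster E (M.erase v ∪ N)) := by
  apply subset_antisymm
  · refine cluster_subset (fun x hx => ?_) fun a b ha h => ?_
    · by_cases hxv : x = v
      · simp [hxv]
      · exact Finset.mem_insert_of_mem (subset_cluster (by simp [hxv, hx]))
    · rw [graphOf_adj] at h
      obtain ⟨hab, h⟩ := h
      by_cases hbv : b = v
      · simp [hbv]
      refine Finset.mem_insert_of_mem ?_
      by_cases hav : a = v
      · subst hav
        refine subset_cluster (Finset.mem_union_right _ ((starPair_mem_iff hbv).1 ?_))
        simp only [Finset.mem_union] at h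
        have key : ∀ e ∈ E, e.1 ≠ a ∧ e.2 ≠ a := fun e he => by
          have := mem_pairsIn.1 (hE he); simp at this; tauto
        rcases h with (h | h) | (h | h)
        exacts [Or.inl h, absurd rfl (key _ h).1, Or.inr h, absurd rfl (key _ h).2]
      · have ha' : a ∈ cluster E (M.erase v ∪ N) := (Finset.mem_insert.1 ha).resolve_left hav
        refine mem_cluster_of_adj ha' (graphOf_adj.2 ⟨hab, ?_⟩)
        have key : ∀ e ∈ N.map (starPair v), e.1 = v ∨ e.2 = v :=
          fun e he => eq_or_eq_of_mem_map_starPair he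
        simp only [Finset.mem_union] at h
        rcases h with (h | h) | (h | h)
        · have := key _ h; simp_all
        · exact Or.inl h
        · have := key _ h; simp_all
        · exact Or.inr h
  · refine Finset.insert_subset (subset_cluster hv) fun x hx => ?_
    obtain ⟨u, hu, h⟩ := mem_cluster.1 hx
    have h' := h.mono (graphOf_mono (Finset.subset_union_right (s₁ := N.map (starPair v))))
    rcases Finset.mem_union.1 hu with hu | hu
    · exact mem_cluster.2 ⟨u, Finset.mem_of_mem_erase hu, h'⟩
    · have huv : u ≠ v := fun e => hN (e ▸ hu)
      refine mem_cluster.2 ⟨v, hv, SimpleGraph.Reachable.trans (SimpleGraph.Adj.reachable ?_) h'⟩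
      rw [graphOf_adj]
      refine ⟨huv.symm, ((starPair_mem_iff huv).2 hu).imp ?_ ?_⟩ <;>
        exact fun h => Finset.mem_union_left _ h

lemma notMem_cluster_of_pairsIn (hE : E ⊆ pairsIn (S.erase v)) (hM : M ⊆ S) (hN : N ⊆ S.erase v) :
    v ∉ cluster E (M.erase v ∪ N) := fun h => by
  have := cluster_subset_of_pairsIn hE
    (Finset.union_subset (Finset.erase_subset_erase v hM) hN) h
  simp at this

end Clusters

section Exploration

variable {n : ℕ} {p : ℝ}

/-- Exploring the cluster of `M`, the number of vertices of `A` left unexposed, rescaled by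
`(1 - p)⁻¹` per step, is a martingale; this bounds its second moment at the end of explorations
lasting at most `t` steps. -/
lemma bernE_sq_cluster_le (h0 : 0 ≤ p) (h1 : p < 1) {b : ℝ} (hb : 0 ≤ b) (t : ℕ) :
    ∀ (S M A : Finset (Fin n)) (c : ℝ), M ⊆ S → A ⊆ S → S.card * p ≤ b →
      bernE p (pairsIn S) (fun E => if (cluster E M).card ≤ t then
          (((A \ cluster E M).card : ℝ) * (1 - p)⁻¹ ^ (cluster E M).card - c) ^ 2 else 0) ≤
        ((A \ M).card - c) ^ 2 + t * b * (1 - p)⁻¹ ^ (2 * t) := by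
  have hq : 0 < 1 - p := by linarith
  have hr : 1 ≤ (1 - p)⁻¹ := (one_le_inv₀ hq).2 (by linarith)
  set r := (1 - p)⁻¹ with hrdef
  have hrq : r * (1 - p) = 1 := inv_mul_cancel₀ hq.ne'
  induction t with
  | zero =>
    intro S M A c hM hA hS
    rcases M.eq_empty_or_nonempty with rfl | ⟨v, hv⟩
    · simp [cluster_empty, bernE_const]
    · have : ∀ E, ¬ (cluster E M).card ≤ 0 := fun E h => by
        have := Finset.card_eq_zero.1 (Nat.le_zero.1 h)
        have h2 := subset_cluster (E := E) hv
        simp [this] at h2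
      simp only [this, if_false, bernE_const]
      positivity
  | succ t ih =>
    intro S M A c hM hA hS
    rcases M.eq_empty_or_nonempty with rfl | ⟨v, hv⟩
    · simp only [cluster_empty, Finset.card_empty, Nat.zero_le, if_true, Finset.sdiff_empty,
        pow_zero, mul_one, bernE_const]
      have : 0 ≤ ((t + 1 : ℕ) : ℝ) * b * r ^ (2 * (t + 1)) := by positivity
      linarith
    rw [bernE_pairsIn p (hM hv)]
    have hAM : A \ M ⊆ S.erase v := fun x hx => by
      rw [Finset.mem_sdiff] at hx
      exact Finset.mem_erase.2 ⟨fun h => hx.2 (h ▸ hv), hA hx.1⟩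
    have step : ∀ N ⊆ S.erase v, bernE p (pairsIn (S.erase v)) (fun E =>
        if (cluster (N.map (starPair v) ∪ E) M).card ≤ t + 1 then
          (((A \ cluster (N.map (starPair v) ∪ E) M).card : ℝ) *
            r ^ (cluster (N.map (starPair v) ∪ E) M).card - c) ^ 2 else 0) ≤
        r ^ 2 * (((((A \ M) \ N).card : ℝ) - c * (1 - p)) ^ 2 + t * b * r ^ (2 * t)) := by
      intro N hN
      have hvN : v ∉ N := fun h => by simpa using hN h
      have hih := ih (S.erase v) (M.erase v ∪ N) (A.erase v) (c * (1 - p))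
        (Finset.union_subset (Finset.erase_subset_erase v hM) hN)
        (Finset.erase_subset_erase v hA) (le_trans (by
          gcongr
          exact Finset.erase_subset _ _) hS)
      have hsd : A.erase v \ (M.erase v ∪ N) = (A \ M) \ N := by
        ext x
        simp only [Finset.mem_sdiff, Finset.mem_erase, Finset.mem_union]
        by_cases hx : x = v
        · subst hx; simp [hv]
        · tauto
      rw [hsd] at hih
      refine le_trans (le_of_eq ?_) (mul_le_mul_of_nonneg_left hih (sq_nonneg r))
      rw [← bernE_const_mul]
      refine bernE_congr fun E hE => ?_
      have hnot := notMem_cluster_of_pairsIn hE hM hN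
      rw [cluster_explore hE hv hvN, Finset.card_insert_of_notMem hnot]
      have hsd' : A \ insert v (cluster E (M.erase v ∪ N)) =
          A.erase v \ cluster E (M.erase v ∪ N) := by
        ext x
        simp only [Finset.mem_sdiff, Finset.mem_erase, Finset.mem_insert]
        tauto
      rw [hsd']
      simp only [Nat.add_le_add_iff_right]
      split_ifs
      · rw [← mul_pow]
        congr 1
        rw [pow_succ, mul_sub]
        linear_combination c * hrq
      · simp
    refine (bernE_mono h0 h1.le step).trans ?_
    rw [bernE_const_mul, bernE_add, bernE_const, bernE_sq_card_sdiff hAM]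
    have hcard : ((A \ M).card : ℝ) * p ≤ b := le_trans (by
      gcongr
      exact Finset.sdiff_subset.trans hA) hS
    have e1 : r ^ 2 * (((1 - p) * ((A \ M).card : ℝ) - c * (1 - p)) ^ 2) =
        ((A \ M).card - c) ^ 2 := by
      have : r ^ 2 * (((1 - p) * ((A \ M).card : ℝ) - c * (1 - p)) ^ 2) =
        (r * (1 - p)) ^ 2 * ((A \ M).card - c) ^ 2 := by ring
      rw [this, hrq]; ring
    have e2 : ((A \ M).card : ℝ) * (p * (1 - p)) ≤ b := by nlinarith
    have e3 : r ^ 2 * b ≤ b * r ^ (2 * (t + 1)) := by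
      rw [mul_comm]
      gcongr
      omega
    have e4 : r ^ 2 * (t * b * r ^ (2 * t)) = t * (b * r ^ (2 * (t + 1))) := by
      rw [mul_add, pow_add]; ring
    have e5 := mul_le_mul_of_nonneg_left e2 (sq_nonneg r)
    push_cast
    nlinarith

/-- Expected cluster sizes in the subcritical regime. -/
lemma bernE_card_cluster_le (h0 : 0 ≤ p) (h1 : p ≤ 1) {ρ : ℝ} (hρ : ρ < 1) :
    ∀ (S M : Finset (Fin n)), M ⊆ S → S.card * p ≤ ρ →
      bernE p (pairsIn S) (fun E => ((cluster E M).card : ℝ)) ≤ M.card / (1 - ρ) := by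
  have h1ρ : 0 < 1 - ρ := by linarith
  intro S
  induction S using Finset.strongInduction with
  | H S ih =>
    intro M hM hS
    rcases M.eq_empty_or_nonempty with rfl | ⟨v, hv⟩
    · simp [cluster_empty, bernE_const]
    rw [bernE_pairsIn p (hM hv)]
    have hle : ((S.erase v).card : ℝ) * p ≤ ρ := le_trans (by
      gcongr
      exact Finset.erase_subset _ _) hS
    have step : ∀ N ⊆ S.erase v, bernE p (pairsIn (S.erase v)) (fun E =>
        ((cluster (N.map (starPair v) ∪ E) M).card : ℝ)) ≤
        (1 + (M.card - 1) / (1 - ρ)) + (1 - ρ)⁻¹ * N.card := by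
      intro N hN
      have hvN : v ∉ N := fun h => by simpa using hN h
      have hih := ih _ (Finset.erase_ssubset (hM hv)) (M.erase v ∪ N)
        (Finset.union_subset (Finset.erase_subset_erase v hM) hN) hle
      have heq : bernE p (pairsIn (S.erase v)) (fun E =>
          ((cluster (N.map (starPair v) ∪ E) M).card : ℝ)) =
          1 + bernE p (pairsIn (S.erase v)) (fun E =>
            ((cluster E (M.erase v ∪ N)).card : ℝ)) := by
        rw [← bernE_const (p := p) (D := pairsIn (S.erase v)) 1, ← bernE_add]
        refine bernE_congr fun E hE => ?_
        rw [cluster_explore hE hv hvN,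
          Finset.card_insert_of_notMem (notMem_cluster_of_pairsIn hE hM hN)]
        push_cast; ring
      have hc : ((M.erase v ∪ N).card : ℝ) ≤ (M.card - 1) + N.card := by
        have h := Finset.card_union_le (M.erase v) N
        have h' := Finset.card_erase_add_one hv
        rw [← h']
        push_cast
        have : ((M.erase v ∪ N).card : ℝ) ≤ (M.erase v).card + N.card := by exact_mod_cast h
        linarith
      rw [heq]
      have := div_le_div_of_nonneg_right hc h1ρ.le
      have e : ((M.card : ℝ) - 1 + N.card) / (1 - ρ) =
        (M.card - 1) / (1 - ρ) + (1 - ρ)⁻¹ * N.card := by ring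
      linarith
    refine (bernE_mono h0 h1 step).trans ?_
    rw [bernE_add, bernE_const, bernE_const_mul, bernE_card]
    have e : (M.card : ℝ) / (1 - ρ) =
        1 + (M.card - 1) / (1 - ρ) + (1 - ρ)⁻¹ * ρ := by
      field_simp; ring
    rw [e]
    gcongr
    linarith

/-- Given the cluster of `M`, the edges away from it are fresh. -/
lemma bernE_fresh :
    ∀ (S M : Finset (Fin n)) (h : Finset (Fin n) → Finset (Fin n × Fin n) → ℝ), M ⊆ S →
      bernE p (pairsIn S)
          (fun E => h (S \ cluster E M) (E ∩ pairsIn (S \ cluster E M))) =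
        bernE p (pairsIn S)
          (fun E => bernE p (pairsIn (S \ cluster E M)) (h (S \ cluster E M))) := by
  intro S
  induction S using Finset.strongInduction with
  | H S ih =>
    intro M h hM
    rcases M.eq_empty_or_nonempty with rfl | ⟨v, hv⟩
    · simp only [cluster_empty, Finset.sdiff_empty, bernE_const]
      exact bernE_congr fun E hE => by rw [Finset.inter_eq_left.2 hE]
    rw [bernE_pairsIn p (hM hv), bernE_pairsIn p (hM hv)]
    refine bernE_congr fun N hN => ?_
    have hvN : v ∉ N := fun h => by simpa using hN h
    have hsd : ∀ E ⊆ pairsIn (S.erase v), S \ cluster (N.map (starPair v) ∪ E) M =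
        S.erase v \ cluster E (M.erase v ∪ N) := fun E hE => by
      rw [cluster_explore hE hv hvN]
      ext x
      simp only [Finset.mem_sdiff, Finset.mem_erase, Finset.mem_insert]
      tauto
    have hih := ih _ (Finset.erase_ssubset (hM hv)) (M.erase v ∪ N) h
        (Finset.union_subset (Finset.erase_subset_erase v hM) hN)
    refine Eq.trans (bernE_congr fun E hE => ?_) (hih.trans (bernE_congr fun E hE => ?_))
    · rw [hsd E hE]
      congr 1
      ext e
      simp only [Finset.mem_inter, Finset.mem_union]
      refine ⟨fun ⟨he, he'⟩ => ⟨he.resolve_left fun hst => ?_, he'⟩, fun he => ⟨Or.inr he.1, he.2⟩⟩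
      have := pairsIn_mono Finset.sdiff_subset he'
      rw [mem_pairsIn] at this
      rcases eq_or_eq_of_mem_map_starPair hst with h' | h' <;> simp [h'] at this
    · rw [hsd E hE]

end Exploration

section GiantCluster

variable {n : ℕ} {β : ℝ}

/-- The percolation probability of the Swendsen–Wang dynamics. -/
noncomputable def bondProb (β : ℝ) (n : ℕ) : ℝ := 1 - Real.exp (-(β / n))

lemma bondProb_nonneg (hβ : 0 < β) : 0 ≤ bondProb β n := by
  have : Real.exp (-(β / n)) ≤ 1 := Real.exp_le_one_iff.2 (neg_nonpos.2 (by positivity))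
  unfold bondProb; linarith

lemma bondProb_lt_one : bondProb β n < 1 := by
  have := Real.exp_pos (-(β / n))
  unfold bondProb; linarith

lemma bondProb_le : bondProb β n ≤ β / n := by
  have := Real.add_one_le_exp (-(β / n))
  unfold bondProb; linarith

lemma inv_one_sub_bondProb_pow (T : ℕ) :
    (1 - bondProb β n)⁻¹ ^ T = Real.exp (β * T / n) := by
  rw [bondProb, sub_sub_cancel, ← Real.exp_neg, neg_neg, ← Real.exp_nat_mul]
  congr 1; ring

lemma card_le_real (S : Finset (Fin n)) : (S.card : ℝ) ≤ n := by
  exact_mod_cast (Finset.card_le_univ S).trans_eq (Fintype.card_fin n)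

lemma card_mul_bondProb_le (hβ : 0 < β) (hn : 0 < n) (S : Finset (Fin n)) :
    S.card * bondProb β n ≤ β := by
  have hn' : (0 : ℝ) < n := by exact_mod_cast hn
  calc S.card * bondProb β n ≤ n * (β / n) := by
        gcongr
        · exact bondProb_nonneg hβ
        · exact_mod_cast card_le_real S
        · exact bondProb_le
    _ = β := by field_simp

lemma card_sdiff_real {S C : Finset (Fin n)} (h : C ⊆ S) :
    ((S \ C).card : ℝ) = S.card - C.card := by
  rw [Finset.card_sdiff_of_subset h, Nat.cast_sub (Finset.card_le_card h)]

lemma bernE_sq_cluster_bondProb_le (hβ : 0 < β) (hn : 0 < n) {t : ℕ} (ht : t ≤ n)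
    {S M A : Finset (Fin n)} (c : ℝ) (hM : M ⊆ S) (hA : A ⊆ S) :
    bernE (bondProb β n) (pairsIn S) (fun E => if (cluster E M).card ≤ t then
        (((A \ cluster E M).card : ℝ) * Real.exp (β * (cluster E M).card / n) - c) ^ 2 else 0) ≤
      ((A \ M).card - c) ^ 2 + β * Real.exp (2 * β) * t := by
  have hn' : (0 : ℝ) < n := by exact_mod_cast hn
  have h := bernE_sq_cluster_le (bondProb_nonneg (n := n) hβ) bondProb_lt_one hβ.le t S M A c hM hA
    (card_mul_bondProb_le hβ hn S)
  simp only [inv_one_sub_bondProb_pow] at h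
  refine h.trans ?_
  have : Real.exp (β * ((2 * t : ℕ) : ℝ) / n) ≤ Real.exp (2 * β) := by
    rw [Real.exp_le_exp, div_le_iff₀ hn']
    have : (t : ℝ) ≤ n := by exact_mod_cast ht
    push_cast
    nlinarith
  have h2 := mul_le_mul_of_nonneg_left this (by positivity : 0 ≤ (t : ℝ) * β)
  linarith

lemma bernE_sq_cluster_singleton_le (hβ : 0 < β) (hn : 0 < n) {t : ℕ} (ht : t ≤ n)
    {S A : Finset (Fin n)} {v : Fin n} (hv : v ∈ S) (hA : A ⊆ S) :
    bernE (bondProb β n) (pairsIn S) (fun E => if (cluster E {v}).card ≤ t then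
        (((A \ cluster E {v}).card : ℝ) * Real.exp (β * (cluster E {v}).card / n) - A.card) ^ 2
        else 0) ≤ 1 + β * Real.exp (2 * β) * t := by
  refine (bernE_sq_cluster_bondProb_le hβ hn ht A.card (by simpa using hv) hA).trans ?_
  gcongr
  have h1 : ((A \ {v}).card : ℝ) ≤ A.card := by
    exact_mod_cast Finset.card_le_card Finset.sdiff_subset
  have h2 : (A.card : ℝ) ≤ (A \ {v}).card + 1 := by
    have := Finset.card_le_card_sdiff_add_card (s := A) (t := {v})
    rw [Finset.card_singleton] at this
    exact_mod_cast this
  nlinarith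

/-- Averaging a cluster statistic over the root controls it on all large clusters. -/
lemma bernP_exists_large_le (hβ : 0 < β) (hn : 0 < n) {S : Finset (Fin n)}
    {Y : Fin n → Finset (Fin n × Fin n) → ℝ} (hY : ∀ v E, 0 ≤ Y v E)
    (hYc : ∀ v w E, w ∈ cluster E {v} → Y w E = Y v E) {e η b ε : ℝ} (hη : 0 < η) (hb : 0 < b)
    (hε0 : 0 ≤ ε) (he : ∀ v ∈ S, bernE (bondProb β n) (pairsIn S) (Y v) ≤ e) (hε : e ≤ ε * (η * b)) :
    bernP (bondProb β n) (pairsIn S)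
      (fun E => ∃ v ∈ S, η * n < (cluster E {v}).card ∧ b < Y v E) ≤ ε := by
  have hn' : (0 : ℝ) < n := by exact_mod_cast hn
  refine bernP_le_of_bernE_le (bondProb_nonneg hβ) bondProb_lt_one.le
    (f := fun E => ∑ v ∈ S, Y v E) (b := η * n * b) (e := ε * (η * b) * S.card)
    (by positivity) (fun E _ => Finset.sum_nonneg fun v _ => hY v E) ?_ ?_ ?_
  · rintro E hE ⟨v, hv, hT, hbY⟩
    calc η * n * b ≤ (cluster E {v}).card * Y v E := by
          gcongr
      _ = ∑ w ∈ cluster E {v}, Y w E := by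
          rw [Finset.sum_congr rfl fun w hw => hYc v w E hw, Finset.sum_const, nsmul_eq_mul]
      _ ≤ _ := Finset.sum_le_sum_of_subset_of_nonneg
          (cluster_subset_of_pairsIn hE (by simpa using hv)) fun w _ _ => hY w E
  · rw [bernE_sum]
    calc _ ≤ ∑ v ∈ S, e := Finset.sum_le_sum he
      _ = e * S.card := by rw [Finset.sum_const, nsmul_eq_mul, mul_comm]
      _ ≤ _ := by gcongr
  · have := mul_le_mul_of_nonneg_left (card_le_real S) (by positivity : 0 ≤ ε * (η * b))
    linarith

/-- Every large cluster meets each set `A` in about the expected number of vertices. -/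
lemma bernP_large_deviating_le (hβ : 0 < β) (hn : 0 < n) {S A : Finset (Fin n)} (hA : A ⊆ S)
    {η b ε : ℝ} (hη : 0 < η) (hb : 0 < b) (hε0 : 0 ≤ ε)
    (hε : 1 + β * Real.exp (2 * β) * n ≤ ε * (η * b)) :
    bernP (bondProb β n) (pairsIn S) (fun E => ∃ v ∈ S, η * n < (cluster E {v}).card ∧
      b < (((A \ cluster E {v}).card : ℝ) * Real.exp (β * (cluster E {v}).card / n)
        - A.card) ^ 2) ≤ ε := by
  refine bernP_exists_large_le hβ hn (Y := fun v E => (((A \ cluster E {v}).card : ℝ) *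
    Real.exp (β * (cluster E {v}).card / n) - A.card) ^ 2) (fun _ _ => sq_nonneg _)
    (fun v w E h => by rw [cluster_singleton_eq h]) hη hb hε0 (fun v hv => ?_) hε
  have h := bernE_sq_cluster_singleton_le hβ hn le_rfl hv hA
  refine (le_of_eq (bernE_congr fun E _ => ?_)).trans h
  rw [if_pos (by exact_mod_cast card_le_real (cluster E {v}))]

/-- The clusters avoiding `cluster E {v}`, when the remaining vertices are subcritical. -/
lemma bernE_sum_cluster_sdiff_le (hβ : 0 < β) {ρ : ℝ} (hρ : ρ < 1)
    {S : Finset (Fin n)} {v : Fin n} (hv : v ∈ S) :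
    bernE (bondProb β n) (pairsIn S) (fun E =>
      if ((S \ cluster E {v}).card : ℝ) * bondProb β n ≤ ρ then
        ∑ w ∈ S \ cluster E {v}, ((cluster E {w}).card : ℝ) else 0) ≤ n / (1 - ρ) := by
  have h1ρ : 0 < 1 - ρ := by linarith
  have hp0 := bondProb_nonneg (n := n) hβ
  have hp1 := (bondProb_lt_one (β := β) (n := n)).le
  have key := bernE_fresh (p := bondProb β n) S {v} (fun R E' =>
    if (R.card : ℝ) * bondProb β n ≤ ρ then ∑ w ∈ R, ((cluster E' {w}).card : ℝ) else 0)
    (by simpa using hv)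
  refine (le_of_eq ((bernE_congr fun E hE => ?_).trans key)).trans ?_
  · congr 1
    refine Finset.sum_congr rfl fun w hw => ?_
    rw [cluster_inter_pairsIn (fun e he => (mem_pairsIn.1 (hE he)).1) _ (by simpa using hw)]
    intro a b ha hab
    rw [Finset.mem_sdiff] at ha ⊢
    exact ⟨(mem_of_adj_pairsIn hE hab).2, fun hb => ha.2 (mem_cluster_of_adj hb hab.symm)⟩
  · rw [← bernE_const (p := bondProb β n) (D := pairsIn S) (n / (1 - ρ))]
    refine bernE_mono hp0 hp1 fun E _ => ?_
    set R := S \ cluster E {v}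
    by_cases hR : (R.card : ℝ) * bondProb β n ≤ ρ
    · simp only [hR, if_true]
      rw [bernE_sum]
      calc _ ≤ ∑ w ∈ R, 1 / (1 - ρ) := Finset.sum_le_sum fun w hw => by
            simpa using bernE_card_cluster_le hp0 hp1 hρ R {w} (by simpa using hw) hR
        _ = R.card / (1 - ρ) := by rw [Finset.sum_const, nsmul_eq_mul]; ring
        _ ≤ n / (1 - ρ) := div_le_div_of_nonneg_right (card_le_real R) h1ρ.le
    · simp only [hR, if_false, bernE_const]
      positivity

/-- Large clusters with subcritical complement leave only small clusters. -/
lemma bernP_large_remainder_le (hβ : 0 < β) (hn : 0 < n) {S : Finset (Fin n)}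
    {η b ε ρ : ℝ} (hρ : ρ < 1) (hη : 0 < η) (hb : 0 < b) (hε0 : 0 ≤ ε)
    (hε : n / (1 - ρ) ≤ ε * (η * b)) :
    bernP (bondProb β n) (pairsIn S) (fun E => ∃ v ∈ S, η * n < (cluster E {v}).card ∧
      b < if ((S \ cluster E {v}).card : ℝ) * bondProb β n ≤ ρ then
        ∑ w ∈ S \ cluster E {v}, ((cluster E {w}).card : ℝ) else 0) ≤ ε := by
  refine bernP_exists_large_le hβ hn (Y := fun v E =>
      if ((S \ cluster E {v}).card : ℝ) * bondProb β n ≤ ρ then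
        ∑ w ∈ S \ cluster E {v}, ((cluster E {w}).card : ℝ) else 0) (fun v E => ?_)
    (fun v w E h => by rw [cluster_singleton_eq h]) hη hb hε0
    (fun v hv => bernE_sum_cluster_sdiff_le hβ hρ hv) hε
  split_ifs
  · exact Finset.sum_nonneg fun _ _ => Nat.cast_nonneg _
  · exact le_rfl

lemma drift_of_small {x0 γ : ℝ} (hn : 0 < n) (hγ : β * x0 - 1 - γ = γ) (hβ : 0 < β)
    {s T : ℝ} (hs : x0 * n ≤ s) (hT0 : 0 ≤ T) (hTs : T ≤ s) (hT : β * T ≤ γ * n) :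
    s + γ * T ≤ (s - T) * Real.exp (β * T / n) := by
  have hn' : (0 : ℝ) < n := by exact_mod_cast hn
  have h1 := Real.add_one_le_exp (β * T / n)
  have h2 := mul_le_mul_of_nonneg_left h1 (sub_nonneg.2 hTs)
  refine le_trans ?_ h2
  have h3 : β * x0 ≤ β * s / n := by
    rw [le_div_iff₀ hn']; nlinarith
  have h4 : β * T / n ≤ γ := by rwa [div_le_iff₀ hn']
  have e : (s - T) * (β * T / n + 1) = s + T * (β * s / n - 1 - β * T / n) := by ring
  rw [e]
  nlinarith

set_option maxHeartbeats 1000000 in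
/-- A supercritical percolation has a cluster of linear size. -/
lemma exists_large_cluster (hβ : 0 < β) {x0 ε : ℝ} (hx0 : 1 < β * x0) (hε : 0 < ε) :
    ∃ η : ℝ, 0 < η ∧ ∃ N : ℕ, ∀ n : ℕ, N ≤ n → ∀ S : Finset (Fin n), x0 * n ≤ S.card →
      bernP (bondProb β n) (pairsIn S)
        (fun E => ¬ ∃ v ∈ S, η * n < (cluster E {v}).card) ≤ ε := by
  set C := β * Real.exp (2 * β) with hC
  have hCpos : 0 < C := by positivity
  set γ := (β * x0 - 1) / 2 with hγ
  have hγpos : 0 < γ := by rw [hγ]; linarith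
  set η1 := min (γ / β) 1 with hη1
  have hη1pos : 0 < η1 := lt_min (by positivity) one_pos
  have hη1le : η1 ≤ 1 := min_le_right _ _
  have hη1γ : β * η1 ≤ γ := by
    have := min_le_left (γ / β) 1
    rwa [le_div_iff₀ hβ, mul_comm] at this
  have hx0pos : 0 < x0 := by
    by_contra h
    push Not at h
    nlinarith
  set K := max 1 (2 * C / ε) with hK
  have hK1 : 1 ≤ K := le_max_left _ _
  have hKC : 2 * C ≤ ε * K := by
    have := le_max_right 1 (2 * C / ε)
    rwa [div_le_iff₀' hε] at this
  set η := min η1 (ε * (γ ^ 2 * η1 ^ 2) / (16 * K ^ 2 * C)) with hη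
  have hηpos : 0 < η := lt_min hη1pos (by positivity)
  have hηη1 : η ≤ η1 := min_le_left _ _
  have hηb : 16 * K ^ 2 * C * η ≤ ε * (γ ^ 2 * η1 ^ 2) := by
    have := min_le_right η1 (ε * (γ ^ 2 * η1 ^ 2) / (16 * K ^ 2 * C))
    rwa [le_div_iff₀' (by positivity)] at this
  refine ⟨η, hηpos, ⌈1 / (C * η)⌉₊ + ⌈(2 * K / x0) ^ 2⌉₊ + 1, fun n hN S hS => ?_⟩
  have hn : 0 < n := by omega
  have hn' : (0 : ℝ) < n := by exact_mod_cast hn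
  have hn1 : 1 ≤ C * η * n := by
    have h1 : 1 / (C * η) ≤ n :=
      (Nat.le_ceil _).trans (by exact_mod_cast (by omega : ⌈1 / (C * η)⌉₊ ≤ n))
    rwa [div_le_iff₀' (by positivity)] at h1
  have hn2 : 2 * K * Real.sqrt n ≤ x0 * n := by
    have h1 : (2 * K / x0) ^ 2 ≤ n :=
      (Nat.le_ceil _).trans (by exact_mod_cast (by omega : ⌈(2 * K / x0) ^ 2⌉₊ ≤ n))
    have h2 := Real.le_sqrt_of_sq_le h1
    rw [div_le_iff₀ hx0pos] at h2
    nlinarith [Real.mul_self_sqrt hn'.le, Real.sqrt_nonneg (n : ℝ)]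
  have hsq1 : 1 ≤ Real.sqrt n := by
    rw [Real.one_le_sqrt]; exact_mod_cast hn
  have hsqsq : Real.sqrt n * Real.sqrt n = n := Real.mul_self_sqrt hn'.le
  obtain ⟨m, hm1, hm2⟩ : ∃ m : ℕ, K * Real.sqrt n ≤ m ∧ (m : ℝ) ≤ 2 * K * Real.sqrt n := by
    refine ⟨⌈K * Real.sqrt n⌉₊, Nat.le_ceil _, ?_⟩
    have := (Nat.ceil_lt_add_one (by positivity : 0 ≤ K * Real.sqrt n)).le
    nlinarith
  have hmS : m ≤ S.card := by
    have : (m : ℝ) ≤ S.card := by linarith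
    exact_mod_cast this
  have hmpos : (0 : ℝ) < m := by nlinarith
  obtain ⟨M, hMS, hMc⟩ := Finset.exists_subset_card_eq hmS
  have hp0 := bondProb_nonneg (n := n) hβ
  have hp1 := (bondProb_lt_one (β := β) (n := n)).le
  have floor_le : ∀ y : ℝ, 0 < y → y ≤ 1 → ⌊y * n⌋₊ ≤ n := fun y _ hy1 => by
    refine Nat.floor_le_of_le ?_
    nlinarith
  have hP1 : bernP (bondProb β n) (pairsIn S)
      (fun E => (cluster E M).card ≤ ⌊η1 * n⌋₊) ≤ ε / 2 := by
    have h := bernE_sq_cluster_bondProb_le hβ hn (floor_le η1 hη1pos hη1le)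
      ((S \ M).card : ℝ) hMS subset_rfl
    refine bernP_le_of_bernE_le hp0 hp1 (b := (K * Real.sqrt n) ^ 2) (by positivity)
      (fun E _ => by split_ifs <;> positivity) (fun E hE hT => ?_) h ?_
    · rw [if_pos hT]
      have hsub := cluster_subset_of_pairsIn hE hMS
      have hT' : ((cluster E M).card : ℝ) ≤ η1 * n :=
        (Nat.le_floor_iff (by positivity)).1 hT
      have hd := drift_of_small (γ := γ) hn (by rw [hγ]; ring) hβ hS (Nat.cast_nonneg _)
        (by exact_mod_cast Finset.card_le_card hsub) (by nlinarith : β * ((cluster E M).card : ℝ) ≤ γ * n)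
      rw [card_sdiff_real hsub, card_sdiff_real hMS, hMc]
      have : 0 ≤ γ * ((cluster E M).card : ℝ) := by positivity
      have h5 : K * Real.sqrt n ≤ (S.card - (cluster E M).card) *
        Real.exp (β * (cluster E M).card / n) - (S.card - m) := by linarith
      exact pow_le_pow_left₀ (by positivity) h5 2
    · have h6 : ((⌊η1 * n⌋₊ : ℕ) : ℝ) ≤ n := by exact_mod_cast floor_le η1 hη1pos hη1le
      rw [sub_self, mul_pow, Real.sq_sqrt hn'.le, ← hC]
      have h8 : ε * K ≤ ε * K ^ 2 := by
        rw [sq, ← mul_assoc]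
        exact le_mul_of_one_le_right (by positivity) hK1
      have : C ≤ ε / 2 * K ^ 2 := by linarith
      calc (0 : ℝ) ^ 2 + C * (⌊η1 * n⌋₊ : ℕ) ≤ 0 ^ 2 + C * n := by gcongr
        _ = C * n := by ring
        _ ≤ (ε / 2 * K ^ 2) * n := by gcongr
        _ = _ := by ring
  have hP2 : bernP (bondProb β n) (pairsIn S)
      (fun E => ¬ (cluster E M).card ≤ ⌊η1 * n⌋₊ ∧ ∀ v ∈ M, (cluster E {v}).card ≤ ⌊η * n⌋₊) ≤
      ε / 2 := by
    refine bernP_le_of_bernE_le hp0 hp1 (b := γ ^ 2 * (η1 * n) ^ 2 / m)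
      (e := ∑ v ∈ M, (1 + C * ⌊η * n⌋₊))
      (f := fun E => ∑ v ∈ M, if (cluster E {v}).card ≤ ⌊η * n⌋₊ then
        (((S \ cluster E {v}).card : ℝ) * Real.exp (β * (cluster E {v}).card / n) - S.card) ^ 2
        else 0) (by positivity)
      (fun E _ => Finset.sum_nonneg fun v _ => by split_ifs <;> positivity) ?_ ?_ ?_
    · rintro E hE ⟨hT, hv⟩
      have hterm : ∀ v ∈ M, γ ^ 2 * ((cluster E {v}).card : ℝ) ^ 2 ≤
          if (cluster E {v}).card ≤ ⌊η * n⌋₊ then (((S \ cluster E {v}).card : ℝ) *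
            Real.exp (β * (cluster E {v}).card / n) - S.card) ^ 2 else 0 := by
        intro v hvM
        rw [if_pos (hv v hvM)]
        have hsub := cluster_subset_of_pairsIn hE (by simpa using hMS hvM : {v} ⊆ S)
        have hT' : ((cluster E {v}).card : ℝ) ≤ η * n :=
          (Nat.le_floor_iff (by positivity)).1 (hv v hvM)
        have hT'' : β * ((cluster E {v}).card : ℝ) ≤ γ * n := by
          have : η * n ≤ η1 * n := by gcongr
          nlinarith
        have hd := drift_of_small (γ := γ) hn (by rw [hγ]; ring) hβ hS (Nat.cast_nonneg _)
          (by exact_mod_cast Finset.card_le_card hsub) hT''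
        rw [card_sdiff_real hsub, ← mul_pow]
        exact pow_le_pow_left₀ (by positivity) (by linarith) 2
      refine le_trans ?_ (Finset.sum_le_sum hterm)
      rw [← Finset.mul_sum, mul_div_assoc]
      refine mul_le_mul_of_nonneg_left ?_ (sq_nonneg γ)
      rw [div_le_iff₀' hmpos]
      have hcs := sq_sum_le_card_mul_sum_sq (s := M) (f := fun v => ((cluster E {v}).card : ℝ))
      rw [hMc] at hcs
      refine le_trans ?_ hcs
      refine pow_le_pow_left₀ (by positivity) ?_ 2
      have h1 : η1 * n ≤ (cluster E M).card := ((Nat.floor_lt (by positivity)).1 (not_le.1 hT)).le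
      refine h1.trans ?_
      rw [cluster_eq_biUnion]
      exact_mod_cast Finset.card_biUnion_le
    · rw [bernE_sum]
      refine Finset.sum_le_sum fun v hv => ?_
      exact bernE_sq_cluster_singleton_le hβ hn (floor_le η hηpos (hηη1.trans hη1le)) (hMS hv)
        subset_rfl
    · rw [Finset.sum_const, nsmul_eq_mul, hMc, ← mul_div_assoc, le_div_iff₀ hmpos]
      have h1 : ((⌊η * n⌋₊ : ℕ) : ℝ) ≤ η * n := Nat.floor_le (by positivity)
      have h2 : 1 + C * (⌊η * n⌋₊ : ℕ) ≤ 2 * (C * η * n) := by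
        have := mul_le_mul_of_nonneg_left h1 hCpos.le
        linarith
      have h3 : (m : ℝ) * m ≤ 4 * K ^ 2 * n := by
        calc (m : ℝ) * m ≤ (2 * K * Real.sqrt n) * (2 * K * Real.sqrt n) := by gcongr
          _ = 4 * K ^ 2 * (Real.sqrt n * Real.sqrt n) := by ring
          _ = _ := by rw [hsqsq]
      calc (m : ℝ) * (1 + C * (⌊η * n⌋₊ : ℕ)) * m = (m * m) * (1 + C * (⌊η * n⌋₊ : ℕ)) := by ring
        _ ≤ (4 * K ^ 2 * n) * (2 * (C * η * n)) := by gcongr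
        _ = (16 * K ^ 2 * C * η) * n ^ 2 / 2 := by ring
        _ ≤ (ε * (γ ^ 2 * η1 ^ 2)) * n ^ 2 / 2 := by gcongr
        _ = _ := by ring
  refine le_trans (bernP_mono hp0 hp1 fun E hE hnot => ?_)
    ((bernP_or_le hp0 hp1 _ _).trans ((add_le_add hP1 hP2).trans (by linarith)))
  by_cases hT : (cluster E M).card ≤ ⌊η1 * n⌋₊
  · exact Or.inl hT
  · refine Or.inr ⟨hT, fun v hv => ?_⟩
    push Not at hnot
    exact Nat.le_floor (hnot v (hMS hv))

end GiantCluster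

section GiantStructure

variable {n q : ℕ} {β : ℝ}

/-- The number of vertices of `A` outside `C` is within `O(√n)` of its typical value when `C` is
an explored cluster. -/
def NearDrift (β K : ℝ) (A C : Finset (Fin n)) : Prop :=
  (((A \ C).card : ℝ) * Real.exp (β * C.card / n) - A.card) ^ 2 ≤ K * n

lemma mul_one_add_half_le_exp_sub_one {z : ℝ} (hz : 0 ≤ z) : z * (1 + z / 2) ≤ Real.exp z - 1 := by
  have := Real.quadratic_le_exp_of_nonneg hz
  nlinarith

/-- Removing the giant cluster leaves a subcritical graph. -/
lemma card_sdiff_mul_bondProb_le (hβ : 0 < β) (hn : 0 < n) {η K : ℝ} (hη : 0 < η)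
    (hK : K * n ≤ (β * η ^ 2 / 4 * n) ^ 2) {S C : Finset (Fin n)} (hCS : C ⊆ S)
    (hC : η * n < C.card) (h : NearDrift β K S C) :
    ((S \ C).card : ℝ) * bondProb β n ≤ (1 + β * η / 4) / (1 + β * η / 2) := by
  have hn' : (0 : ℝ) < n := by exact_mod_cast hn
  have h1 := le_of_sq_le_sq (h.trans hK) (by positivity)
  have hSC := card_sdiff_real hCS
  set W : ℝ := ((S \ C).card : ℝ)
  set T : ℝ := (C.card : ℝ)
  have hW : 0 ≤ W := Nat.cast_nonneg _
  set z := β * T / n with hz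
  set b := β * W / n with hb
  have hb0 : 0 ≤ b := by positivity
  have hzη : β * η < z := by
    rw [hz, lt_div_iff₀ hn', mul_assoc]
    exact mul_lt_mul_of_pos_left hC hβ
  have hβη : 0 < β * η := by positivity
  have hzpos : 0 < z := hβη.trans hzη
  have h2 : W * Real.exp z - W ≤ T + β * η ^ 2 / 4 * n := by linarith
  have h3 : b * (Real.exp z - 1) ≤ z + (β * η) ^ 2 / 4 := by
    calc b * (Real.exp z - 1) = β / n * (W * Real.exp z - W) := by rw [hb]; ring
      _ ≤ β / n * (T + β * η ^ 2 / 4 * n) := by gcongr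
      _ = z + (β * η) ^ 2 / 4 := by rw [hz]; field_simp
  have h4 : z * (b * (1 + z / 2)) ≤ z * (1 + β * η / 4) := by
    have := mul_le_mul_of_nonneg_left (mul_one_add_half_le_exp_sub_one hzpos.le) hb0
    nlinarith
  have h5 := le_of_mul_le_mul_left h4 hzpos
  have h6 : W * bondProb β n ≤ b := by
    calc W * bondProb β n ≤ W * (β / n) := by gcongr; exact bondProb_le
      _ = b := by rw [hb]; ring
  rw [le_div_iff₀ (by positivity)]
  refine (mul_le_mul_of_nonneg_right h6 (by positivity)).trans (le_trans ?_ h5)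
  gcongr

set_option maxHeartbeats 1000000 in
/-- With high probability, percolation on a supercritical set `S` has a giant cluster of predictable
intersection with each `A k`, and the remaining clusters are small. -/
lemma bernP_not_giant_le (q : ℕ) (hβ : 0 < β) {x0 ε : ℝ} (hx0 : 1 < β * x0) (hε : 0 < ε) :
    ∃ η : ℝ, 0 < η ∧ ∃ K : ℝ, 0 < K ∧ ∃ N : ℕ, ∀ n : ℕ, N ≤ n → ∀ S : Finset (Fin n),
      x0 * n ≤ S.card → ∀ A : Fin q → Finset (Fin n), (∀ k, A k ⊆ S) →
      bernP (bondProb β n) (pairsIn S) (fun E => ¬ ∃ v ∈ S, η * n < (cluster E {v}).card ∧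
        NearDrift β K S (cluster E {v}) ∧ (∀ k, NearDrift β K (A k) (cluster E {v})) ∧
        ∑ w ∈ S \ cluster E {v}, ((cluster E {w}).card : ℝ) ≤ K * n) ≤ ε := by
  have hε4 : 0 < ε / 4 := by positivity
  obtain ⟨η, hη, N, hN⟩ := exists_large_cluster hβ hx0 hε4
  set ρ := (1 + β * η / 4) / (1 + β * η / 2) with hρ
  have hρ1 : ρ < 1 := by
    rw [hρ, div_lt_one (by positivity)]
    have : 0 < β * η := by positivity
    linarith
  have h1ρ : 0 < 1 - ρ := by linarith
  set C := β * Real.exp (2 * β) with hC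
  have hCpos : 0 < C := by positivity
  set K := (1 + C) * (4 * (q + 1)) / (ε * η) + 4 / ((1 - ρ) * ε * η) with hK
  have hKpos : 0 < K := by positivity
  refine ⟨η, hη, K, hKpos, N + ⌈K / (β * η ^ 2 / 4) ^ 2⌉₊ + 1, fun n hn S hS A hA => ?_⟩
  have hn0 : 0 < n := by omega
  have hn' : (0 : ℝ) < n := by exact_mod_cast hn0
  have hn1 : (1 : ℝ) ≤ n := by exact_mod_cast hn0
  have hp0 := bondProb_nonneg (n := n) hβ
  have hp1 := (bondProb_lt_one (β := β) (n := n)).le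
  have hKn : K * n ≤ (β * η ^ 2 / 4 * n) ^ 2 := by
    have h1 : K / (β * η ^ 2 / 4) ^ 2 ≤ n :=
      (Nat.le_ceil _).trans (by exact_mod_cast (by omega : ⌈K / (β * η ^ 2 / 4) ^ 2⌉₊ ≤ n))
    rw [div_le_iff₀' (by positivity)] at h1
    calc K * n ≤ ((β * η ^ 2 / 4) ^ 2 * n) * n := by gcongr
      _ = _ := by ring
  have hKb : 0 < K * n := by positivity
  have hε1 : 1 + C * n ≤ ε / (4 * (q + 1)) * (η * (K * n)) := by
    have h1 : (1 + C) * (4 * (q + 1)) / (ε * η) ≤ K := by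
      rw [hK]; exact le_add_of_nonneg_right (by positivity)
    calc 1 + C * n ≤ (1 + C) * n := by linarith
      _ = ε / (4 * (q + 1)) * (η * ((1 + C) * (4 * (q + 1)) / (ε * η) * n)) := by field_simp
      _ ≤ _ := by gcongr
  have hε2 : n / (1 - ρ) ≤ ε / 4 * (η * (K * n)) := by
    have h1 : 4 / ((1 - ρ) * ε * η) ≤ K := by
      rw [hK]; exact le_add_of_nonneg_left (by positivity)
    calc n / (1 - ρ) = ε / 4 * (η * (4 / ((1 - ρ) * ε * η) * n)) := by field_simp
      _ ≤ _ := by gcongr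
  have hε0 : 0 ≤ ε / (4 * (q + 1)) := by positivity
  have hε3 : ε / (4 * (q + 1)) ≤ ε / 4 := by
    gcongr; linarith [(Nat.cast_nonneg q : (0 : ℝ) ≤ q)]
  have hE1 := hN n (by omega) S hS
  have hE2 := bernP_large_deviating_le hβ hn0 (subset_refl S) hη hKb hε0 hε1
  have hE3 := bernP_exists_le (D := pairsIn S) hp0 hp1 (Finset.univ : Finset (Fin q)) (fun k E =>
    ∃ v ∈ S, η * n < (cluster E {v}).card ∧ K * n < (((A k \ cluster E {v}).card : ℝ) *
      Real.exp (β * (cluster E {v}).card / n) - (A k).card) ^ 2)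
  have hE3' := hE3.trans (Finset.sum_le_sum fun k _ =>
    bernP_large_deviating_le hβ hn0 (hA k) hη hKb hε0 hε1)
  have hE4 := bernP_large_remainder_le hβ hn0 (S := S) hρ1 hη hKb hε4.le hε2
  have hE3'' : ∑ _k : Fin q, ε / (4 * ((q : ℝ) + 1)) ≤ ε / 4 := by
    rw [Finset.sum_const, Finset.card_univ, Fintype.card_fin, nsmul_eq_mul]
    have hq0 : (0 : ℝ) ≤ q := Nat.cast_nonneg q
    rw [← mul_div_assoc, div_le_div_iff₀ (by positivity) (by norm_num)]
    nlinarith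
  refine le_trans (bernP_mono hp0 hp1 fun E hE hnot => ?_)
    ((bernP_or_le hp0 hp1 _ _).trans (add_le_add hE1 ((bernP_or_le hp0 hp1 _ _).trans
      (add_le_add (hE2.trans hε3) ((bernP_or_le hp0 hp1 _ _).trans
        (add_le_add (hE3'.trans hE3'') hE4))))) |>.trans (by linarith))
  by_contra hcon
  simp only [not_or, not_not] at hcon
  obtain ⟨⟨v, hv, hvη⟩, h2, h3, h4⟩ := hcon
  push Not at h2 h3 h4
  have hcS := cluster_subset_of_pairsIn hE (by simpa using hv : {v} ⊆ S)
  have h2v := h2 v hv hvη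
  have h4v := h4 v hv hvη
  rw [if_pos (card_sdiff_mul_bondProb_le hβ hn0 hη hKn hcS hvη h2v)] at h4v
  exact hnot ⟨v, hv, hvη, h2v, fun k => h3 k (Finset.mem_univ k) v hv hvη, h4v⟩

/-- The vertices of spin `j`. -/
def spinClass (σ : Conf n q) (j : Fin q) : Finset (Fin n) :=
  Finset.univ.filter (fun v => σ v = j)

lemma mem_spinClass {σ : Conf n q} {j : Fin q} {v : Fin n} : v ∈ spinClass σ j ↔ σ v = j := by
  simp [spinClass]

lemma pairsIn_spinClass_subset (σ : Conf n q) (j : Fin q) :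
    pairsIn (spinClass σ j) ⊆ monoPairs σ := fun e he => by
  rw [mem_pairsIn, mem_spinClass, mem_spinClass] at he
  simp [monoPairs, he.1, he.2.1, he.2.2]

lemma spin_eq_of_adj {σ : Conf n q} {E : Finset (Fin n × Fin n)} (hE : E ⊆ monoPairs σ)
    {u v : Fin n} (h : (graphOf E).Adj u v) : σ u = σ v := by
  rcases (graphOf_adj.1 h).2 with h | h <;> have := hE h <;> simp_all [monoPairs]

lemma spinClass_closed {σ : Conf n q} {E : Finset (Fin n × Fin n)} (hE : E ⊆ monoPairs σ)
    (j : Fin q) (u w : Fin n) (hu : u ∈ spinClass σ j) (h : (graphOf E).Adj u w) :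
    w ∈ spinClass σ j := by
  rw [mem_spinClass] at hu ⊢
  rw [← hu, spin_eq_of_adj hE h]

lemma cluster_inter_spinClass {σ : Conf n q} {E : Finset (Fin n × Fin n)} (hE : E ⊆ monoPairs σ)
    {j : Fin q} {v : Fin n} (hv : v ∈ spinClass σ j) :
    cluster (E ∩ pairsIn (spinClass σ j)) {v} = cluster E {v} :=
  cluster_inter_pairsIn (fun e he => by have := hE he; simp_all [monoPairs])
    (spinClass_closed hE j) (by simpa using hv)

lemma cluster_subset_spinClass {σ : Conf n q} {E : Finset (Fin n × Fin n)} (hE : E ⊆ monoPairs σ)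
    {j : Fin q} {v : Fin n} (hv : v ∈ spinClass σ j) : cluster E {v} ⊆ spinClass σ j :=
  cluster_subset (by simpa using hv) (spinClass_closed hE j)

/-- Subcritical spin classes have small clusters. -/
lemma bernE_sum_cluster_spinClass_le (hβ : 0 < β) {ρ : ℝ} (hρ : ρ < 1) (σ : Conf n q) {j : Fin q}
    (hj : β * (spinClass σ j).card ≤ ρ * n) (hn : 0 < n) :
    bernE (bondProb β n) (monoPairs σ)
      (fun E => ∑ w ∈ spinClass σ j, ((cluster E {w}).card : ℝ)) ≤ n / (1 - ρ) := by
  have hn' : (0 : ℝ) < n := by exact_mod_cast hn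
  have h1ρ : 0 < 1 - ρ := by linarith
  have hp0 := bondProb_nonneg (n := n) hβ
  have hp1 := (bondProb_lt_one (β := β) (n := n)).le
  have hS : ((spinClass σ j).card : ℝ) * bondProb β n ≤ ρ := by
    calc ((spinClass σ j).card : ℝ) * bondProb β n ≤ (spinClass σ j).card * (β / n) := by
          gcongr; exact bondProb_le
      _ = β * (spinClass σ j).card / n := by ring
      _ ≤ ρ := by rwa [div_le_iff₀ hn']
  have h1 : bernE (bondProb β n) (monoPairs σ)
      (fun E => ∑ w ∈ spinClass σ j, ((cluster E {w}).card : ℝ)) =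
      bernE (bondProb β n) (pairsIn (spinClass σ j))
        (fun E => ∑ w ∈ spinClass σ j, ((cluster E {w}).card : ℝ)) := by
    rw [← bernE_inter (pairsIn_spinClass_subset σ j)]
    refine bernE_congr fun E hE => Finset.sum_congr rfl fun w hw => ?_
    rw [cluster_inter_spinClass hE hw]
  rw [h1, bernE_sum]
  calc _ ≤ ∑ w ∈ spinClass σ j, 1 / (1 - ρ) := Finset.sum_le_sum fun w hw => by
        simpa using bernE_card_cluster_le hp0 hp1 hρ (spinClass σ j) {w} (by simpa using hw) hS
    _ = (spinClass σ j).card / (1 - ρ) := by rw [Finset.sum_const, nsmul_eq_mul]; ring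
    _ ≤ n / (1 - ρ) := div_le_div_of_nonneg_right (card_le_real _) h1ρ.le

/-- The event that the percolation step from `σ` has a giant cluster inside the spin class `J`, of
typical intersection with every set `A k`, while all other clusters are small. -/
def HasGiant (β η K : ℝ) (σ : Conf n q) (J : Fin q) (A : Fin q → Finset (Fin n))
    (E : Finset (Fin n × Fin n)) : Prop :=
  ∃ v ∈ spinClass σ J, η * n < (cluster E {v}).card ∧
    NearDrift β K (spinClass σ J) (cluster E {v}) ∧
    (∀ k, NearDrift β K (A k ∩ spinClass σ J) (cluster E {v})) ∧
    ∑ w ∈ (cluster E {v})ᶜ, ((cluster E {w}).card : ℝ) ≤ K * n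

lemma NearDrift.mono {K K' : ℝ} (hK : K ≤ K') {A C : Finset (Fin n)} (h : NearDrift β K A C) :
    NearDrift β K' A C :=
  le_trans h (mul_le_mul_of_nonneg_right hK (Nat.cast_nonneg n))

set_option maxHeartbeats 1000000 in
lemma bernP_not_hasGiant_le (hq : 0 < q) (hβ : 0 < β) {x0 ρ ε : ℝ} (hx0 : 1 < β * x0) (hρ : ρ < 1)
    (hε : 0 < ε) :
    ∃ η : ℝ, 0 < η ∧ ∃ K : ℝ, 0 < K ∧ ∃ N : ℕ, ∀ n : ℕ, N ≤ n → ∀ (σ : Conf n q) (J : Fin q),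
      x0 * n ≤ (spinClass σ J).card → (∀ j ≠ J, β * (spinClass σ j).card ≤ ρ * n) →
      ∀ A : Fin q → Finset (Fin n),
      bernP (bondProb β n) (monoPairs σ) (fun E => ¬ HasGiant β η K σ J A E) ≤ ε := by
  have h1ρ : 0 < 1 - ρ := by linarith
  obtain ⟨η, hη, K, hK, N, hN⟩ := bernP_not_giant_le q hβ hx0 (half_pos hε)
  have hq' : (0 : ℝ) < q := by exact_mod_cast hq
  set L := 2 * q / ((1 - ρ) * ε) with hL
  have hLpos : 0 < L := by positivity
  refine ⟨η, hη, K + L, by positivity, N + 1, fun n hn σ J hJ hj A => ?_⟩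
  have hn0 : 0 < n := by omega
  have hn' : (0 : ℝ) < n := by exact_mod_cast hn0
  have hp0 := bondProb_nonneg (n := n) hβ
  have hp1 := (bondProb_lt_one (β := β) (n := n)).le
  set S := spinClass σ J with hS
  have hE1 := hN n (by omega) S hJ (fun k => A k ∩ S) (fun k => Finset.inter_subset_right)
  rw [bernP, ← bernE_inter (pairsIn_spinClass_subset σ J)] at hE1
  have hE2 : bernP (bondProb β n) (monoPairs σ) (fun E => L * n <
      ∑ j ∈ Finset.univ.erase J, ∑ w ∈ spinClass σ j, ((cluster E {w}).card : ℝ)) ≤ ε / 2 := by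
    refine bernP_le_of_bernE_le hp0 hp1 (b := L * n) (by positivity)
      (fun E _ => Finset.sum_nonneg fun _ _ => Finset.sum_nonneg fun _ _ => Nat.cast_nonneg _)
      (fun E _ h => h.le) (e := q * (n / (1 - ρ))) ?_ ?_
    · rw [bernE_sum]
      calc _ ≤ ∑ j ∈ Finset.univ.erase J, n / (1 - ρ) := Finset.sum_le_sum fun j hjJ =>
            bernE_sum_cluster_spinClass_le hβ hρ σ (hj j (Finset.ne_of_mem_erase hjJ)) hn0
        _ ≤ ∑ j : Fin q, n / (1 - ρ) := Finset.sum_le_sum_of_subset_of_nonneg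
            (Finset.erase_subset _ _) fun _ _ _ => by positivity
        _ = _ := by simp
    · rw [hL]; apply le_of_eq; field_simp
  refine le_trans (bernP_mono hp0 hp1 fun E hE hnot => ?_)
    ((bernP_or_le hp0 hp1 _ _).trans ((add_le_add hE1 hE2).trans (by linarith)))
  by_contra hcon
  simp only [not_or, not_not, not_lt] at hcon
  obtain ⟨⟨v, hv, hvη, h2, h3, h4⟩, h5⟩ := hcon
  rw [cluster_inter_spinClass hE hv] at hvη h2 h4
  simp only [cluster_inter_spinClass hE hv] at h3
  refine hnot ⟨v, hv, hvη, h2.mono (by linarith), fun k => (h3 k).mono (by linarith), ?_⟩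
  have h6 : ∑ w ∈ S \ cluster E {v}, ((cluster E {w}).card : ℝ) ≤ K * n := by
    refine le_trans (le_of_eq (Finset.sum_congr rfl fun w hw => ?_)) h4
    rw [cluster_inter_spinClass hE (Finset.mem_sdiff.1 hw).1]
  have hsub : (cluster E {v})ᶜ ⊆
      (S \ cluster E {v}) ∪ (Finset.univ.erase J).biUnion (spinClass σ) := fun w hw => by
    by_cases hwJ : σ w = J
    · exact Finset.mem_union_left _ (Finset.mem_sdiff.2 ⟨mem_spinClass.2 hwJ, by simpa using hw⟩)
    · exact Finset.mem_union_right _ (Finset.mem_biUnion.2 ⟨σ w, by simpa using hwJ, mem_spinClass.2 rfl⟩)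
  calc _ ≤ ∑ w ∈ (S \ cluster E {v}) ∪ (Finset.univ.erase J).biUnion (spinClass σ),
        ((cluster E {w}).card : ℝ) :=
        Finset.sum_le_sum_of_subset_of_nonneg hsub fun _ _ _ => Nat.cast_nonneg _
    _ ≤ ∑ w ∈ S \ cluster E {v}, ((cluster E {w}).card : ℝ) +
        ∑ w ∈ (Finset.univ.erase J).biUnion (spinClass σ), ((cluster E {w}).card : ℝ) := by
        rw [← Finset.sum_union_inter]
        exact le_add_of_nonneg_right (Finset.sum_nonneg fun _ _ => Nat.cast_nonneg _)
    _ ≤ K * n + L * n := by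
        refine add_le_add h6 (le_trans (le_of_eq (Finset.sum_biUnion ?_)) h5)
        intro i _ j _ hij
        rw [Function.onFun, Finset.disjoint_left]
        exact fun w hi hj => hij ((mem_spinClass.1 hi).symm.trans (mem_spinClass.1 hj))
    _ = (K + L) * n := by ring

end GiantStructure

section Coloring

variable {n q : ℕ} {β : ℝ} {E : Finset (Fin n × Fin n)}

/-- Expectation over the random coloring of the components of `(V, E)`. -/
noncomputable def colorE (E : Finset (Fin n × Fin n)) (G : Conf n q → ℝ) : ℝ :=
  ∑ z : Conf n q, (if ∀ u v : Fin n, (graphOf E).Reachable u v → z u = z v then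
    (q : ℝ)⁻¹ ^ numComps E else 0) * G z

lemma sum_swStep_mul (σ : Conf n q) (G : Conf n q → ℝ) :
    ∑ z, swStep n q β σ z * G z = bernE (bondProb β n) (monoPairs σ) (fun E => colorE E G) := by
  simp only [swStep, bernE, colorE, bondProb, sub_sub_cancel, Finset.sum_mul, Finset.mul_sum]
  rw [Finset.sum_comm]
  exact Finset.sum_congr rfl fun _ _ => Finset.sum_congr rfl fun _ _ => by ring

lemma colorE_mono {G H : Conf n q → ℝ}
    (h : ∀ z, (∀ u v : Fin n, (graphOf E).Reachable u v → z u = z v) → G z ≤ H z) :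
    colorE E G ≤ colorE E H := by
  refine Finset.sum_le_sum fun z _ => ?_
  split_ifs with hz
  · exact mul_le_mul_of_nonneg_left (h z hz) (by positivity)
  · simp

lemma colorE_const_sub (c : ℝ) (G H : Conf n q → ℝ) :
    colorE E (fun z => G z - c * H z) = colorE E G - c * colorE E H := by
  simp only [colorE, Finset.mul_sum, ← Finset.sum_sub_distrib]
  exact Finset.sum_congr rfl fun _ _ => by ring

lemma colorE_sum {α : Type*} (s : Finset α) (G : α → Conf n q → ℝ) :
    colorE E (fun z => ∑ i ∈ s, G i z) = ∑ i ∈ s, colorE E (G i) := by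
  simp only [colorE, Finset.mul_sum]
  exact Finset.sum_comm

lemma colorE_eq_sum_component (E : Finset (Fin n × Fin n)) (G : Conf n q → ℝ) :
    colorE E G = ∑ f : (graphOf E).ConnectedComponent → Fin q,
      (q : ℝ)⁻¹ ^ numComps E * G (fun u => f ((graphOf E).connectedComponentMk u)) := by
  refine (Fintype.sum_of_injective
    (fun (f : (graphOf E).ConnectedComponent → Fin q) (u : Fin n) =>
      f ((graphOf E).connectedComponentMk u)) (fun f g h => ?_) _ _ (fun z hz => ?_)
      fun f => ?_).symm
  · funext c
    induction c using SimpleGraph.ConnectedComponent.ind with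
    | _ u => exact congrFun h u
  · rw [if_neg, zero_mul]
    intro hc
    exact hz ⟨fun c => c.lift z fun u v p _ => hc u v ⟨p⟩, funext fun u => rfl⟩
  · rw [if_pos]
    intro u v h
    exact congrArg f (SimpleGraph.ConnectedComponent.sound h)

lemma colorE_one (hq : 0 < q) : colorE E (fun _ : Conf n q => 1) = 1 := by
  have hq' : (q : ℝ) ≠ 0 := by exact_mod_cast hq.ne'
  rw [colorE_eq_sum_component, Finset.sum_const, Finset.card_univ, Fintype.card_fun,
    Fintype.card_fin, numComps, Nat.card_eq_fintype_card]
  simp [hq']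

lemma sum_mul_eq_zero_of_ne {ι κ : Type*} [Fintype ι] [DecidableEq ι] [Fintype κ] {φ : κ → ℝ}
    (hφ : ∑ x, φ x = 0) {a b : ι} (hab : b ≠ a) : ∑ f : ι → κ, φ (f a) * φ (f b) = 0 := by
  rw [Fintype.sum_equiv (Equiv.funSplitAt a κ) _ (fun y => φ y.1 * φ (y.2 ⟨b, hab⟩))
    (fun f => by simp [Equiv.funSplitAt, Equiv.piSplitAt]), Fintype.sum_prod_type]
  simp only [← Finset.mul_sum]
  rw [← Finset.sum_mul, hφ, zero_mul]

/-- The variance of the number of vertices of `U` receiving the spin `j`. -/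
lemma colorE_sq_card_filter_le (hq : 0 < q) (U : Finset (Fin n)) (j : Fin q) :
    colorE E (fun z => (((U.filter (fun u => z u = j)).card : ℝ) - U.card / q) ^ 2) ≤
      ∑ u ∈ U, ((cluster E {u}).card : ℝ) := by
  have hq' : (q : ℝ) ≠ 0 := by exact_mod_cast hq.ne'
  set φ : Fin q → ℝ := fun x => (if x = j then 1 else 0) - 1 / q with hφ
  have hφ0 : ∑ x, φ x = 0 := by simp [hφ, Finset.sum_sub_distrib, hq']
  have hφ1 : ∀ x, |φ x| ≤ 1 := fun x => by
    have h1 : (1 : ℝ) / q ≤ 1 := by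
      rw [div_le_one (by positivity)]; exact_mod_cast hq
    have h2 : (0 : ℝ) ≤ 1 / q := by positivity
    rw [abs_le, hφ]
    dsimp only
    split_ifs <;> constructor <;> linarith
  have hG : ∀ z : Conf n q, (((U.filter (fun u => z u = j)).card : ℝ) - U.card / q) ^ 2 =
      ∑ u ∈ U, ∑ w ∈ U, φ (z u) * φ (z w) := fun z => by
    have : ((U.filter (fun u => z u = j)).card : ℝ) - U.card / q = ∑ u ∈ U, φ (z u) := by
      simp [hφ, Finset.sum_sub_distrib, div_eq_mul_inv]
    rw [this, sq, Finset.sum_mul_sum]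
  simp only [hG, colorE_sum]
  refine Finset.sum_le_sum fun u _ => ?_
  have hterm : ∀ w ∈ U, colorE E (fun z => φ (z u) * φ (z w)) ≤
      if w ∈ cluster E {u} then 1 else 0 := fun w _ => by
    split_ifs with hw
    · rw [← colorE_one (n := n) (E := E) hq]
      refine colorE_mono fun z _ => (le_abs_self _).trans ?_
      rw [abs_mul]
      exact mul_le_one₀ (hφ1 _) (abs_nonneg _) (hφ1 _)
    · rw [colorE_eq_sum_component, ← Finset.mul_sum, sum_mul_eq_zero_of_ne hφ0, mul_zero]
      intro h
      exact hw (mem_cluster_singleton.2 (SimpleGraph.ConnectedComponent.exact h).symm)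
  refine (Finset.sum_le_sum hterm).trans ?_
  rw [Finset.sum_ite_mem, Finset.sum_const, nsmul_eq_mul, mul_one]
  exact_mod_cast Finset.card_le_card Finset.inter_subset_right

/-- The vertices of `A` outside `C` are nearly equidistributed among the spins. -/
def NearUniform (K : ℝ) (z : Conf n q) (A C : Finset (Fin n)) : Prop :=
  ∀ j, ((((A \ C).filter (fun u => z u = j)).card : ℝ) - ((A \ C).card : ℝ) / q) ^ 2 ≤ K * n

/-- The typical outcome `z` of a Swendsen–Wang step from `σ` with dominant spin `J`. -/
def TypicalStep (β η K : ℝ) (σ : Conf n q) (J : Fin q) (A : Fin q → Finset (Fin n))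
    (z : Conf n q) : Prop :=
  ∃ C ⊆ spinClass σ J, ∃ i, (∀ u ∈ C, z u = i) ∧ η * n < C.card ∧
    NearDrift β K (spinClass σ J) C ∧ (∀ k, NearDrift β K (A k ∩ spinClass σ J) C) ∧
    NearUniform K z Finset.univ C ∧ ∀ k, NearUniform K z (A k) C

lemma one_sub_le_colorE_typicalStep (hq : 0 < q) {η K L ε : ℝ} (hKL : K ≤ L) (hL : 0 < L)
    (hn : 0 < n) (hε : (q + 1) * q * K ≤ ε * L) {σ : Conf n q} {J : Fin q}
    {A : Fin q → Finset (Fin n)} (hE : E ⊆ monoPairs σ) (h : HasGiant β η K σ J A E) :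
    1 - ε ≤ colorE E (fun z => if TypicalStep β η L σ J A z then 1 else 0) := by
  have hn' : (0 : ℝ) < n := by exact_mod_cast hn
  obtain ⟨v, hv, hvη, h2, h3, h4⟩ := h
  set C := cluster E {v}
  set B : Option (Fin q) → Finset (Fin n) := fun o => o.elim Finset.univ A
  set D : Option (Fin q) → Fin q → Conf n q → ℝ := fun o j z =>
    ((((B o \ C).filter (fun u => z u = j)).card : ℝ) - ((B o \ C).card : ℝ) / q) ^ 2 with hD
  have h5 : colorE E (fun z => ∑ o, ∑ j, D o j z) ≤ (q + 1) * q * (K * n) := by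
    simp only [colorE_sum]
    calc _ ≤ ∑ _o : Option (Fin q), ∑ _j : Fin q, K * n := by
          refine Finset.sum_le_sum fun o _ => Finset.sum_le_sum fun j _ => ?_
          refine (colorE_sq_card_filter_le hq (B o \ C) j).trans (le_trans ?_ h4)
          exact Finset.sum_le_sum_of_subset_of_nonneg
            (fun u hu => by simpa using (Finset.mem_sdiff.1 hu).2) fun _ _ _ => Nat.cast_nonneg _
      _ = _ := by simp; ring
  have h6 : colorE E (fun z : Conf n q => 1 - (L * n)⁻¹ * ∑ o, ∑ j, D o j z) ≤
      colorE E (fun z => if TypicalStep β η L σ J A z then 1 else 0) := by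
    refine colorE_mono fun z hz => ?_
    have hnn : ∀ o j, 0 ≤ D o j z := fun o j => sq_nonneg _
    by_cases hall : ∀ o j, D o j z ≤ L * n
    · rw [if_pos]
      · have := Finset.sum_nonneg fun o (_ : o ∈ Finset.univ) =>
          Finset.sum_nonneg fun j (_ : j ∈ Finset.univ) => hnn o j
        have h7 : 0 ≤ (L * n)⁻¹ * ∑ o, ∑ j, D o j z := by positivity
        linarith
      · exact ⟨C, cluster_subset_spinClass hE hv, z v,
          fun u hu => (hz v u (mem_cluster_singleton.1 hu)).symm, hvη, h2.mono hKL,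
          fun k => (h3 k).mono hKL, hall none, fun k => hall (some k)⟩
    · push Not at hall
      obtain ⟨o, j, hoj⟩ := hall
      have h7 : L * n ≤ ∑ o, ∑ j, D o j z := by
        refine hoj.le.trans ((Finset.single_le_sum (f := fun j => D o j z)
          (fun j _ => hnn o j) (Finset.mem_univ j)).trans ?_)
        exact Finset.single_le_sum (f := fun o => ∑ j, D o j z)
          (fun o _ => Finset.sum_nonneg fun j _ => hnn o j) (Finset.mem_univ o)
      have h8 : 1 ≤ (L * n)⁻¹ * ∑ o, ∑ j, D o j z := by
        rw [inv_mul_eq_div, le_div_iff₀ (by positivity), one_mul]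
        exact h7
      have h9 : (0 : ℝ) ≤ if TypicalStep β η L σ J A z then 1 else 0 := by split_ifs <;> norm_num
      linarith
  refine le_trans ?_ h6
  rw [colorE_const_sub, colorE_one hq]
  have h10 : (L * n)⁻¹ * colorE E (fun z => ∑ o, ∑ j, D o j z) ≤ ε := by
    rw [inv_mul_eq_div, div_le_iff₀ (by positivity)]
    refine h5.trans ?_
    have := mul_le_mul_of_nonneg_right hε hn'.le
    linarith
  linarith

/-- A Swendsen–Wang step from a configuration with one supercritical and otherwise subcritical spin
classes is typical with high probability. -/
theorem sum_swStep_typicalStep_ge (hq : 0 < q) (hβ : 0 < β) {x0 ρ ε : ℝ} (hx0 : 1 < β * x0)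
    (hρ : ρ < 1) (hε : 0 < ε) :
    ∃ η : ℝ, 0 < η ∧ ∃ K : ℝ, 0 < K ∧ ∃ N : ℕ, ∀ n : ℕ, N ≤ n → ∀ (σ : Conf n q) (J : Fin q),
      x0 * n ≤ (spinClass σ J).card → (∀ j ≠ J, β * (spinClass σ j).card ≤ ρ * n) →
      ∀ A : Fin q → Finset (Fin n),
      1 - ε ≤ ∑ z, swStep n q β σ z * if TypicalStep β η K σ J A z then 1 else 0 := by
  obtain ⟨η, hη, K, hK, N, hN⟩ := bernP_not_hasGiant_le hq hβ hx0 hρ (half_pos hε)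
  have hq' : (0 : ℝ) < q := by exact_mod_cast hq
  set L := K + 2 * ((q + 1) * q * K) / ε with hL
  have hL1 : 2 * ((q + 1) * q * K) / ε ≤ L := le_add_of_nonneg_left hK.le
  have hKL : K ≤ L := le_add_of_nonneg_right (by positivity)
  have hL0 : 0 < L := hK.trans_le hKL
  rw [div_le_iff₀ hε] at hL1
  refine ⟨η, hη, L, hL0, N + 1, fun n hn σ J hJ hj A => ?_⟩
  have hp0 := bondProb_nonneg (n := n) hβ
  have hp1 := (bondProb_lt_one (β := β) (n := n)).le
  have hE1 := hN n (by omega) σ J hJ hj A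
  rw [sum_swStep_mul]
  calc 1 - ε ≤ (1 - ε / 2) + (-1) * bernP (bondProb β n) (monoPairs σ)
        (fun E => ¬ HasGiant β η K σ J A E) := by linarith
    _ = bernE (bondProb β n) (monoPairs σ) (fun E => (1 - ε / 2) +
        (-1) * if ¬ HasGiant β η K σ J A E then 1 else 0) := by
        rw [bernE_add, bernE_const_mul, bernE_const, bernP]
        congr!
    _ ≤ _ := by
        refine bernE_mono hp0 hp1 fun E hE => ?_
        by_cases h : HasGiant β η K σ J A E
        · simp only [h, not_true_eq_false, if_false, mul_zero, add_zero]
          exact one_sub_le_colorE_typicalStep hq hKL hL0 (by omega) (by linarith) hE h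
        · simp only [h, not_false_eq_true, if_true]
          have : 0 ≤ colorE E (fun z => if TypicalStep β η L σ J A z then (1 : ℝ) else 0) := by
            refine Finset.sum_nonneg fun z _ => mul_nonneg (by split_ifs <;> positivity) ?_
            dsimp only
            split_ifs <;> norm_num
          linarith

end Coloring

section Drift

variable {β : ℝ}

/-- The size of the dominant spin class for which `t` is the typical giant component size. -/
noncomputable def classOfGiant (β t : ℝ) : ℝ := t / (1 - Real.exp (-(β * t)))

lemma one_sub_exp_neg_pos {z : ℝ} (hz : 0 < z) : 0 < 1 - Real.exp (-z) :=
  sub_pos.2 (Real.exp_lt_one_iff.2 (neg_lt_zero.2 hz))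

lemma sq_mul_exp_neg_le {z : ℝ} (hz : 0 ≤ z) :
    z ^ 2 * Real.exp (-z) ≤ (1 - Real.exp (-z)) ^ 2 := by
  have h1 : z / 2 ≤ Real.sinh (z / 2) := Real.self_le_sinh_iff.2 (by linarith)
  rw [Real.sinh_eq] at h1
  set u := Real.exp (-(z / 2)) with hu
  have hu0 : 0 < u := Real.exp_pos _
  have h2 : Real.exp (-z) = u ^ 2 := by
    rw [hu, ← Real.exp_nat_mul]; congr 1; push_cast; ring
  have h3 : Real.exp (z / 2) * u = 1 := by rw [hu, ← Real.exp_add]; simp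
  have h4 : z * u ≤ 1 - u ^ 2 := by
    have := mul_le_mul_of_nonneg_right h1 hu0.le
    nlinarith
  rw [h2, ← mul_pow]
  exact pow_le_pow_left₀ (by positivity) h4 2

lemma monotoneOn_inv_one_sub_exp_neg_sub_inv :
    MonotoneOn (fun z : ℝ => (1 - Real.exp (-z))⁻¹ - z⁻¹) (Set.Ioi 0) := by
  have hder : ∀ z ∈ Set.Ioi (0 : ℝ), HasDerivAt (fun z : ℝ => (1 - Real.exp (-z))⁻¹ - z⁻¹)
      (-Real.exp (-z) / (1 - Real.exp (-z)) ^ 2 - -(z ^ 2)⁻¹) z := fun z hz => by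
    have h1 : HasDerivAt (fun z : ℝ => 1 - Real.exp (-z)) (Real.exp (-z)) z := by
      simpa using ((hasDerivAt_id z).neg.exp).const_sub 1
    exact (h1.inv (one_sub_exp_neg_pos hz).ne').sub (hasDerivAt_inv (ne_of_gt hz))
  refine monotoneOn_of_deriv_nonneg (convex_Ioi 0)
    (fun z hz => (hder z hz).continuousAt.continuousWithinAt)
    (fun z hz => (hder z (interior_subset hz)).differentiableAt.differentiableWithinAt)
    fun z hz => ?_
  replace hz := interior_subset hz
  rw [(hder z hz).deriv]
  have hz0 : 0 < z := hz
  have h1 := one_sub_exp_neg_pos hz0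
  rw [sub_neg_eq_add, neg_div, neg_add_eq_sub, sub_nonneg, ← one_div,
    div_le_div_iff₀ (by positivity) (by positivity), one_mul, mul_comm]
  exact sq_mul_exp_neg_le hz0.le

lemma classOfGiant_eq (hβ : 0 < β) {t : ℝ} (ht : 0 < t) :
    classOfGiant β t = t * ((1 - Real.exp (-(β * t)))⁻¹ - (β * t)⁻¹) + β⁻¹ := by
  rw [classOfGiant]; field_simp; ring

lemma mul_abs_sub_le_classOfGiant (hβ : 0 < β) {s t : ℝ} (hs : 0 < s) (ht : 0 < t) :
    (classOfGiant β s - β⁻¹) / s * |t - s| ≤ |classOfGiant β t - classOfGiant β s| := by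
  have hslope : (classOfGiant β s - β⁻¹) / s = (1 - Real.exp (-(β * s)))⁻¹ - (β * s)⁻¹ := by
    rw [classOfGiant_eq hβ hs, add_sub_cancel_right, mul_div_cancel_left₀ _ hs.ne']
  have hmono := monotoneOn_inv_one_sub_exp_neg_sub_inv
  rw [hslope, classOfGiant_eq hβ hs, classOfGiant_eq hβ ht]
  rcases le_total s t with h | h
  · have := hmono (Set.mem_Ioi.2 (by positivity : 0 < β * s))
      (Set.mem_Ioi.2 (by positivity : 0 < β * t)) (by gcongr)
    rw [abs_of_nonneg (by linarith)]
    refine le_trans ?_ (le_abs_self _)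
    dsimp only at this
    nlinarith
  · have := hmono (Set.mem_Ioi.2 (by positivity : 0 < β * t))
      (Set.mem_Ioi.2 (by positivity : 0 < β * s)) (by gcongr)
    rw [abs_of_nonpos (by linarith)]
    refine le_trans ?_ (neg_le_abs _)
    dsimp only at this
    nlinarith

lemma inv_lt_classOfGiant (hβ : 0 < β) {t : ℝ} (ht : 0 < t) : β⁻¹ < classOfGiant β t := by
  have h := one_sub_exp_neg_pos (by positivity : 0 < β * t)
  rw [classOfGiant, lt_div_iff₀ h, inv_mul_lt_iff₀ hβ]
  have := Real.add_one_lt_exp (by nlinarith [mul_pos hβ ht] : -(β * t) ≠ 0)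
  linarith

lemma classOfGiant_lt (hβ : 0 < β) {t : ℝ} (ht : 0 < t) : classOfGiant β t < t + β⁻¹ := by
  have h := one_sub_exp_neg_pos (by positivity : 0 < β * t)
  have h1 := Real.add_one_lt_exp (by positivity : β * t ≠ 0)
  have h2 : Real.exp (β * t) * Real.exp (-(β * t)) = 1 := by rw [← Real.exp_add]; simp
  have h3 := mul_lt_mul_of_pos_right h1 (Real.exp_pos (-(β * t)))
  rw [classOfGiant, div_lt_iff₀ h]
  have : (t + β⁻¹) * (1 - Real.exp (-(β * t))) =
      t + β⁻¹ * (1 - (β * t + 1) * Real.exp (-(β * t))) := by field_simp; ring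
  rw [this]
  have : 0 < β⁻¹ * (1 - (β * t + 1) * Real.exp (-(β * t))) := by
    apply mul_pos (by positivity); linarith
  linarith

lemma lt_classOfGiant (hβ : 0 < β) {t : ℝ} (ht : 0 < t) : t < classOfGiant β t := by
  have h := one_sub_exp_neg_pos (by positivity : 0 < β * t)
  rw [classOfGiant, lt_div_iff₀ h]
  have := Real.exp_pos (-(β * t))
  nlinarith

lemma classOfGiant_injOn (hβ : 0 < β) {s t : ℝ} (hs : 0 < s) (ht : 0 < t)
    (h : classOfGiant β s = classOfGiant β t) : s = t := by
  have h1 := mul_abs_sub_le_classOfGiant hβ hs ht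
  rw [← h, sub_self, abs_zero] at h1
  have h2 : 0 < (classOfGiant β s - β⁻¹) / s := div_pos (sub_pos.2 (inv_lt_classOfGiant hβ hs)) hs
  have h3 : |t - s| ≤ 0 := by
    by_contra hc
    push Not at hc
    nlinarith [mul_pos h2 hc]
  have := abs_eq_zero.1 (le_antisymm h3 (abs_nonneg _))
  linarith

lemma classOfGiant_eq_one_of_root {lam x : ℝ} (hx : x ∈ Set.Ioo (0 : ℝ) 1)
    (h : Real.exp (-lam * x) = 1 - x) : classOfGiant lam x = 1 := by
  rw [classOfGiant, ← neg_mul, h, sub_sub_cancel, div_self hx.1.ne']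

lemma theta_eq {lam x : ℝ} (hlam : 1 < lam) (hx : x ∈ Set.Ioo (0 : ℝ) 1)
    (h : Real.exp (-lam * x) = 1 - x) : theta lam = x := by
  have hset : {x : ℝ | x ∈ Set.Ioo (0 : ℝ) 1 ∧ Real.exp (-lam * x) = 1 - x} = {x} := by
    refine Set.eq_singleton_iff_unique_mem.2 ⟨⟨hx, h⟩, fun y hy => ?_⟩
    refine classOfGiant_injOn (by linarith : 0 < lam) hy.1.1 hx.1 ?_
    rw [classOfGiant_eq_one_of_root hx h, classOfGiant_eq_one_of_root hy.1 hy.2]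
  rw [theta, if_neg (not_le.2 hlam), hset, csSup_singleton]

/-- The number of vertices, after recoloring, of the dominant spin class. -/
noncomputable def classAfter (q : ℕ) (t : ℝ) : ℝ := 1 / q + (1 - 1 / q) * t

lemma exists_classOfGiant_eq_classAfter {q : ℕ} (hq : 2 ≤ q) (hβ : (q : ℝ) < β) :
    ∃ t ∈ Set.Ioo (0 : ℝ) 1, classOfGiant β t = classAfter q t := by
  have hq' : (2 : ℝ) ≤ q := by exact_mod_cast hq
  have hβ0 : 0 < β := by linarith
  have hqβ : (q : ℝ) / β < 1 := (div_lt_one hβ0).2 hβ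
  set t0 := (1 - q / β) / 2 with ht0
  have hqβ0 : 0 < (q : ℝ) / β := by positivity
  have ht0pos : 0 < t0 := by rw [ht0]; linarith
  have ht01 : t0 ≤ 1 := by rw [ht0]; linarith
  have hcont : ContinuousOn (fun t => classOfGiant β t - classAfter q t) (Set.Icc t0 1) := by
    unfold classOfGiant classAfter
    refine ContinuousOn.sub (continuousOn_id.div (by fun_prop) fun t ht => ?_) (by fun_prop)
    exact (one_sub_exp_neg_pos (mul_pos hβ0 (ht0pos.trans_le ht.1))).ne'
  have hleft : classOfGiant β t0 - classAfter q t0 ≤ 0 := by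
    have h1 := classOfGiant_lt hβ0 ht0pos
    have h2 : t0 + β⁻¹ ≤ classAfter q t0 := by
      have h3 : classAfter q t0 - (t0 + β⁻¹) = (1 - q / β - t0) / q := by
        rw [classAfter]; field_simp; ring
      have h4 : 0 ≤ (1 - q / β - t0) / q := by
        apply div_nonneg _ (by linarith)
        rw [ht0]; linarith
      linarith
    linarith
  have hright' : 0 < classOfGiant β 1 - classAfter q 1 := by
    have h1 := lt_classOfGiant hβ0 one_pos
    rw [classAfter]
    linarith
  obtain ⟨t, ht, h⟩ := intermediate_value_Icc ht01 hcont ⟨hleft, hright'.le⟩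
  refine ⟨t, ⟨ht0pos.trans_le ht.1, lt_of_le_of_ne ht.2 ?_⟩, by linarith⟩
  rintro rfl
  exact hright'.ne' h

lemma slope_gt {q : ℕ} (hq : 2 ≤ q) (hβ : (q : ℝ) < β) {s : ℝ} (hs : s ∈ Set.Ioo (0 : ℝ) 1)
    (h : classOfGiant β s = classAfter q s) :
    1 - 1 / (q : ℝ) < (classOfGiant β s - β⁻¹) / s := by
  have hq' : (2 : ℝ) ≤ q := by exact_mod_cast hq
  rw [lt_div_iff₀ hs.1, h, classAfter, ← one_div β]
  have := one_div_lt_one_div_of_lt (by linarith) hβ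
  linarith

lemma aFix_eq_classAfter {q : ℕ} (hq : 2 ≤ q) (hβ : (q : ℝ) < β) {s : ℝ}
    (hs : s ∈ Set.Ioo (0 : ℝ) 1) (h : classOfGiant β s = classAfter q s) :
    aFix q β = classAfter q s := by
  have hq' : (2 : ℝ) ≤ q := by exact_mod_cast hq
  have hβ0 : 0 < β := by linarith
  have hq1 : 0 < 1 / (q : ℝ) := by positivity
  have hq2 : 1 / (q : ℝ) < 1 := by rw [div_lt_one (by positivity)]; linarith
  have hsupcrit : ∀ x, 1 / (q : ℝ) < x → 1 < β * x := fun x hx => by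
    have h1 : 1 < β * (1 / q) := by rw [mul_one_div, one_lt_div (by positivity)]; exact hβ
    nlinarith
  have hslope := slope_gt hq hβ hs h
  set a := classAfter q s with ha
  have haq : 1 / (q : ℝ) < a := by
    rw [ha, classAfter]
    have : 0 < (1 - 1 / (q : ℝ)) * s := mul_pos (by linarith) hs.1
    linarith
  have ha1 : a ≤ 1 := by
    rw [ha, classAfter]
    have : (1 - 1 / (q : ℝ)) * s ≤ (1 - 1 / (q : ℝ)) * 1 :=
      mul_le_mul_of_nonneg_left hs.2.le (by linarith)
    linarith
  have ha0 : 0 < a := hq1.trans haq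
  have hsa : s < a := h ▸ lt_classOfGiant hβ0 hs.1
  have hset : {x : ℝ | x ∈ Set.Ioc (1 / (q : ℝ)) 1 ∧ F q β x = x} = {a} := by
    refine Set.eq_singleton_iff_unique_mem.2 ⟨⟨⟨haq, ha1⟩, ?_⟩, fun x hx => ?_⟩
    · have hθ : theta (β * a) = s / a := by
        refine theta_eq (hsupcrit a haq) ⟨div_pos hs.1 ha0, (div_lt_one ha0).2 hsa⟩ ?_
        have h1 := (one_sub_exp_neg_pos (mul_pos hβ0 hs.1)).ne'
        have h2 : -(β * a) * (s / a) = -(β * s) := by field_simp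
        rw [h2, ← h, classOfGiant, div_div_cancel₀ hs.1.ne', sub_sub_cancel]
      rw [F, hθ, mul_assoc, div_mul_cancel₀ _ ha0.ne', ← classAfter]
    · obtain ⟨⟨hxq, hx1⟩, hF⟩ := hx
      have hx0 : 0 < x := hq1.trans hxq
      have hne : {y : ℝ | y ∈ Set.Ioo (0 : ℝ) 1 ∧ Real.exp (-(β * x) * y) = 1 - y}.Nonempty := by
        by_contra hcon
        rw [Set.not_nonempty_iff_eq_empty] at hcon
        rw [F, theta, if_neg (not_le.2 (hsupcrit x hxq)), hcon, Real.sSup_empty] at hF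
        linarith
      obtain ⟨y, hy, hroot⟩ := hne
      rw [F, theta_eq (hsupcrit x hxq) hy hroot, mul_assoc] at hF
      set t := y * x with ht
      have ht0 : 0 < t := mul_pos hy.1 hx0
      have hX : classOfGiant β t = x := by
        have h1 : -(β * t) = -(β * x) * y := by rw [ht]; ring
        rw [classOfGiant, h1, hroot, sub_sub_cancel, ht, mul_div_cancel_left₀ _ hy.1.ne']
      have hcontr := mul_abs_sub_le_classOfGiant hβ0 hs.1 ht0
      have hdiff : classOfGiant β t - classOfGiant β s = (1 - 1 / q) * (t - s) := by
        rw [hX, h, ha, classAfter, ← hF]; ring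
      rw [hdiff, abs_mul, abs_of_pos (sub_pos.2 hq2)] at hcontr
      have hts : |t - s| = 0 := by
        by_contra hcon
        have : 0 < |t - s| := lt_of_le_of_ne (abs_nonneg _) (Ne.symm hcon)
        nlinarith
      rw [abs_eq_zero, sub_eq_zero] at hts
      rw [← hF, ha, classAfter, hts]
  rw [aFix, hset, csSup_singleton]

end Drift

section Sorting

variable {n q : ℕ}

/-- Up to `ρ`, the spin `J` has density `a` and the other spins share the rest evenly. -/
def NearMajority (a ρ : ℝ) (X : Conf n q) (J : Fin q) : Prop :=
  |cntFrac X J - a| ≤ ρ ∧ ∀ j ≠ J, |cntFrac X j - (1 - a) / ((q : ℝ) - 1)| ≤ ρ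

lemma abs_sub_le_linf (f g : Fin q → ℝ) (i : Fin q) : |f i - g i| ≤ linf f g :=
  le_ciSup (f := fun i => |f i - g i|) (Set.finite_range _).bddAbove i

lemma exists_nearMajority (hq : 0 < q) {a ρ : ℝ} {X : Conf n q}
    (h : linf (alphaVec X) (kappaVec q a) ≤ ρ) : ∃ J, NearMajority a ρ X J := by
  have : NeZero q := ⟨hq.ne'⟩
  set s := Tuple.sort (cntFrac X)
  refine ⟨s (Fin.rev 0), ?_, fun j hj => ?_⟩
  · simpa [alphaVec, kappaVec] using (abs_sub_le_linf _ _ 0).trans h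
  · obtain ⟨i, rfl⟩ : ∃ i, s (Fin.rev i) = j := ⟨Fin.rev (s.symm j), by simp⟩
    have hi : (i : ℕ) ≠ 0 := fun h0 => hj (by rw [show i = 0 from Fin.ext h0])
    have := (abs_sub_le_linf (alphaVec X) (kappaVec q a) i).trans h
    rwa [kappaVec, if_neg hi] at this

lemma NearMajority.lt {a ρ : ℝ} {X : Conf n q} {J : Fin q} (h : NearMajority a ρ X J)
    (hρ : (1 - a) / ((q : ℝ) - 1) + ρ < a - ρ) {j : Fin q} (hj : j ≠ J) :
    cntFrac X j < cntFrac X J := by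
  have h1 := abs_le.1 h.1
  have h2 := abs_le.1 (h.2 j hj)
  linarith

lemma NearMajority.linf_le {a ρ : ℝ} {X : Conf n q} {J : Fin q} (h : NearMajority a ρ X J)
    (hρ : (1 - a) / ((q : ℝ) - 1) + ρ < a - ρ) : linf (alphaVec X) (kappaVec q a) ≤ ρ := by
  have : NeZero q := ⟨J.pos.ne'⟩
  set s := Tuple.sort (cntFrac X) with hs
  have hJ : s (Fin.rev 0) = J := by
    by_contra hne
    have h1 := Tuple.monotone_sort (cntFrac X)
      (show s.symm J ≤ Fin.rev 0 by rw [← Fin.rev_rev (s.symm J)]; exact Fin.rev_le_rev.2 (Fin.zero_le _))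
    simp only [Function.comp, ← hs, Equiv.apply_symm_apply] at h1
    exact absurd (h.lt hρ hne) (not_lt.2 h1)
  refine ciSup_le fun i => ?_
  by_cases hi : (i : ℕ) = 0
  · rw [kappaVec, if_pos hi, alphaVec, ← hs, show i = 0 from Fin.ext hi, hJ]
    exact h.1
  · rw [kappaVec, if_neg hi, alphaVec, ← hs]
    refine h.2 _ fun hcon => hi ?_
    rw [← hJ] at hcon
    simpa using congrArg Fin.val (Fin.rev_injective (s.injective hcon))

lemma NearMajority.domIdx_eq (hn : 0 < n) {a ρ : ℝ} {X : Conf n q} {J : Fin q}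
    (h : NearMajority a ρ X J) (hρ : (1 - a) / ((q : ℝ) - 1) + ρ < a - ρ) : domIdx X = J := by
  have hn' : (0 : ℝ) < n := by exact_mod_cast hn
  have hlt : ∀ j ≠ J, cntN X j < cntN X J := fun j hj => by
    have := h.lt hρ hj
    rw [cntFrac, cntFrac, div_lt_div_iff_of_pos_right hn'] at this
    exact_mod_cast this
  have hset : {j : ℕ | ∃ hj : j < q, ∀ j' : Fin q, cntN X j' ≤ cntN X ⟨j, hj⟩} = {(J : ℕ)} := by
    refine Set.eq_singleton_iff_unique_mem.2 ⟨⟨J.isLt, fun j' => ?_⟩, fun j hj => ?_⟩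
    · by_cases hj : j' = J
      · rw [hj]
      · exact (hlt j' hj).le
    · obtain ⟨hjq, hj⟩ := hj
      by_contra hne
      exact absurd (hlt ⟨j, hjq⟩ fun hc => hne (congrArg Fin.val hc)) (not_lt.2 (hj J))
  rw [domIdx, hset, csInf_singleton]

lemma NearMajority.alpha1_eq (hn : 0 < n) {a ρ : ℝ} {X : Conf n q} {J : Fin q}
    (h : NearMajority a ρ X J) (hρ : (1 - a) / ((q : ℝ) - 1) + ρ < a - ρ) :
    alpha1 X = cntFrac X J := by
  rw [alpha1, h.domIdx_eq hn hρ, cntFrac, cntN]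
  simp only [Fin.val_inj]

lemma NearMajority.alpha1In_eq (hn : 0 < n) {a ρ : ℝ} {X : Conf n q} {J : Fin q}
    (h : NearMajority a ρ X J) (hρ : (1 - a) / ((q : ℝ) - 1) + ρ < a - ρ) (A : Finset (Fin n)) :
    alpha1In X A = ((A ∩ spinClass X J).card : ℝ) / A.card := by
  rw [alpha1In, h.domIdx_eq hn hρ]
  congr 3
  ext v
  simp [mem_spinClass, Fin.val_inj]

/-- `X` has dominant spin `J`, which has nearly the same density in every `A k`. -/
def BalancedMajority (a ρ : ℝ) (A : Fin q → Finset (Fin n)) (X : Conf n q) (J : Fin q) : Prop :=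
  NearMajority a ρ X J ∧
    ∀ k, |cntFrac X J - ((A k ∩ spinClass X J).card : ℝ) / (A k).card| ≤ ρ

lemma exists_balancedMajority_iff (hn : 0 < n) (hq : 0 < q) {a ρ : ℝ}
    (hρ : (1 - a) / ((q : ℝ) - 1) + ρ < a - ρ) (A : Fin q → Finset (Fin n)) (X : Conf n q) :
    (∃ J, BalancedMajority a ρ A X J) ↔
      linf (alphaVec X) (kappaVec q a) ≤ ρ ∧ ∀ k, |alpha1 X - alpha1In X (A k)| ≤ ρ := by
  constructor
  · rintro ⟨J, h, hA⟩
    refine ⟨h.linf_le hρ, fun k => ?_⟩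
    rw [h.alpha1_eq hn hρ, h.alpha1In_eq hn hρ]
    exact hA k
  · rintro ⟨h, hA⟩
    obtain ⟨J, hJ⟩ := exists_nearMajority hq h
    refine ⟨J, hJ, fun k => ?_⟩
    rw [← hJ.alpha1_eq hn hρ, ← hJ.alpha1In_eq hn hρ]
    exact hA k

end Sorting

section Contraction

variable {n q : ℕ} {β : ℝ}

lemma card_inter_add_card_sdiff_real (A C : Finset (Fin n)) :
    ((A ∩ C).card : ℝ) + (A \ C).card = A.card := by
  exact_mod_cast Finset.card_inter_add_card_sdiff A C

lemma NearDrift.abs_le (hβ : 0 < β) {K : ℝ} {A C : Finset (Fin n)} (h : NearDrift β K A C) :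
    |((A ∩ C).card : ℝ) - A.card * (1 - Real.exp (-(β * (C.card / n))))| ≤ Real.sqrt (K * n) := by
  have h1 := Real.abs_le_sqrt h
  have h2 := card_inter_add_card_sdiff_real A C
  rw [mul_div_assoc] at h1
  set z := β * ((C.card : ℝ) / n) with hz
  have hz0 : 0 ≤ z := by positivity
  have h3 : Real.exp z * Real.exp (-z) = 1 := by rw [← Real.exp_add]; simp
  have h4 : ((A ∩ C).card : ℝ) - A.card * (1 - Real.exp (-z)) =
      -(((A \ C).card * Real.exp z - A.card) * Real.exp (-z)) := by
    linear_combination h2 + ((A \ C).card : ℝ) * h3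
  rw [h4, abs_neg, abs_mul, abs_of_pos (Real.exp_pos _)]
  have h5 : Real.exp (-z) ≤ 1 := Real.exp_le_one_iff.2 (by linarith)
  exact (mul_le_of_le_one_right (abs_nonneg _) h5).trans h1

lemma NearDrift.abs_div_le (hβ : 0 < β) {K : ℝ} {A B C : Finset (Fin n)}
    (h : NearDrift β K B C) (hA : 0 < A.card) :
    |((B ∩ C).card : ℝ) / A.card - B.card / A.card * (1 - Real.exp (-(β * (C.card / n))))| ≤
      Real.sqrt (K * n) / A.card := by
  have hA' : (0 : ℝ) < A.card := by exact_mod_cast hA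
  rw [div_mul_eq_mul_div, ← sub_div, abs_div, abs_of_pos hA']
  gcongr
  exact h.abs_le hβ

lemma card_inter_spinClass_of_const {z : Conf n q} {i : Fin q} {C : Finset (Fin n)}
    (hC : ∀ u ∈ C, z u = i) (A : Finset (Fin n)) :
    (A ∩ spinClass z i).card = (A ∩ C).card + ((A \ C).filter (fun u => z u = i)).card := by
  rw [← Finset.card_union_of_disjoint]
  · congr 1
    ext u
    simp only [Finset.mem_inter, mem_spinClass, Finset.mem_union, Finset.mem_filter,
      Finset.mem_sdiff]
    have := hC u
    tauto
  · rw [Finset.disjoint_left]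
    intro u hu h
    simp only [Finset.mem_inter, Finset.mem_filter, Finset.mem_sdiff] at hu h
    exact h.1.2 hu.2

lemma card_inter_spinClass_of_ne {z : Conf n q} {i j : Fin q} {C : Finset (Fin n)}
    (hC : ∀ u ∈ C, z u = i) (hj : j ≠ i) (A : Finset (Fin n)) :
    (A ∩ spinClass z j).card = ((A \ C).filter (fun u => z u = j)).card := by
  congr 1
  ext u
  simp only [Finset.mem_inter, mem_spinClass, Finset.mem_filter, Finset.mem_sdiff]
  constructor
  · rintro ⟨h1, h2⟩
    exact ⟨⟨h1, fun hu => hj (h2.symm.trans (hC u hu))⟩, h2⟩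
  · rintro ⟨⟨h1, _⟩, h2⟩
    exact ⟨h1, h2⟩

lemma NearUniform.abs_sub_classAfter_le {K : ℝ} {z : Conf n q} {A C : Finset (Fin n)}
    (h : NearUniform K z A C) {i : Fin q} (hC : ∀ u ∈ C, z u = i) (hA : 0 < A.card) :
    |((A ∩ spinClass z i).card : ℝ) / A.card - classAfter q ((A ∩ C).card / A.card)| ≤
      Real.sqrt (K * n) / A.card := by
  have hA' : (0 : ℝ) < A.card := by exact_mod_cast hA
  have h1 := Real.abs_le_sqrt (h i)
  have h2 := card_inter_add_card_sdiff_real A C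
  have hq : (q : ℝ) ≠ 0 := by exact_mod_cast i.pos.ne'
  have h3 : ((A ∩ spinClass z i).card : ℝ) / A.card - classAfter q ((A ∩ C).card / A.card) =
      ((((A \ C).filter (fun u => z u = i)).card : ℝ) - ((A \ C).card : ℝ) / q) / A.card := by
    rw [card_inter_spinClass_of_const hC, eq_sub_of_add_eq' h2, classAfter]
    push_cast
    field_simp
    ring
  rw [h3, abs_div, abs_of_pos hA']
  gcongr

lemma NearUniform.abs_sub_le {K : ℝ} {z : Conf n q} {A C : Finset (Fin n)}
    (h : NearUniform K z A C) {i j : Fin q} (hC : ∀ u ∈ C, z u = i) (hj : j ≠ i)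
    (hA : 0 < A.card) :
    |((A ∩ spinClass z j).card : ℝ) / A.card - (1 - (A ∩ C).card / A.card) / q| ≤
      Real.sqrt (K * n) / A.card := by
  have hA' : (0 : ℝ) < A.card := by exact_mod_cast hA
  have h1 := Real.abs_le_sqrt (h j)
  have h2 := card_inter_add_card_sdiff_real A C
  have h3 : ((A ∩ spinClass z j).card : ℝ) / A.card - (1 - (A ∩ C).card / A.card) / q =
      ((((A \ C).filter (fun u => z u = j)).card : ℝ) - ((A \ C).card : ℝ) / q) / A.card := by
    rw [card_inter_spinClass_of_ne hC hj, eq_sub_of_add_eq' h2]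
    field_simp
  rw [h3, abs_div, abs_of_pos hA']
  gcongr

lemma slope_mul_abs_sub_le (hβ : 0 < β) {s τ η x e ρ : ℝ} (hs : 0 < s) (hη : 0 < η) (hτ : η ≤ τ)
    (he : 0 ≤ e) (h : |τ - x * (1 - Real.exp (-(β * τ)))| ≤ e)
    (hx : |x - classOfGiant β s| ≤ ρ) :
    (classOfGiant β s - β⁻¹) / s * |τ - s| ≤ ρ + e / (1 - Real.exp (-(β * η))) := by
  have hD := one_sub_exp_neg_pos (mul_pos hβ hη)
  have hDτ : 1 - Real.exp (-(β * η)) ≤ 1 - Real.exp (-(β * τ)) := by gcongr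
  have hDpos := hD.trans_le hDτ
  have h1 : |classOfGiant β τ - x| ≤ e / (1 - Real.exp (-(β * η))) := by
    have h2 : classOfGiant β τ - x =
        (τ - x * (1 - Real.exp (-(β * τ)))) / (1 - Real.exp (-(β * τ))) := by
      rw [classOfGiant, sub_div, mul_div_cancel_right₀ _ hDpos.ne']
    rw [h2, abs_div, abs_of_pos hDpos]
    gcongr
  refine (mul_abs_sub_le_classOfGiant hβ hs (hη.trans_le hτ)).trans ?_
  have := abs_sub_le (classOfGiant β τ) x (classOfGiant β s)
  linarith

lemma one_sub_classAfter_div (hq : 2 ≤ q) (t : ℝ) :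
    (1 - classAfter q t) / ((q : ℝ) - 1) = (1 - t) / q := by
  have hq' : (2 : ℝ) ≤ q := by exact_mod_cast hq
  have : (q : ℝ) - 1 ≠ 0 := by linarith
  rw [classAfter]
  field_simp
  ring

/-- A typical step maps nearly balanced configurations to nearly balanced configurations. -/
lemma BalancedMajority.of_typicalStep (hq : 2 ≤ q) (hβ : (q : ℝ) < β) {s : ℝ}
    (hs : s ∈ Set.Ioo (0 : ℝ) 1) (hfix : classOfGiant β s = classAfter q s) (hn : 0 < n)
    {lam η K ρ e : ℝ} (hlam : 0 < lam) (hη : 0 < η) {A : Fin q → Finset (Fin n)}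
    (hA : ∀ k, lam * n ≤ (A k).card) (he : Real.sqrt (K * n) / n = e)
    (hρ1 : (1 - 1 / q) / ((classAfter q s - β⁻¹) / s) *
      (ρ + e / (1 - Real.exp (-(β * η)))) + e ≤ ρ)
    (hρ2 : (1 - 1 / q) * (ρ + e * (1 + lam⁻¹)) + e * (1 + lam⁻¹) ≤ ρ)
    {x z : Conf n q} {J : Fin q} (hx : BalancedMajority (classAfter q s) ρ A x J)
    (hz : TypicalStep β η K x J A z) : ∃ i, BalancedMajority (classAfter q s) ρ A z i := by
  have hq' : (2 : ℝ) ≤ q := by exact_mod_cast hq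
  have hβ0 : 0 < β := by linarith
  have hn' : (0 : ℝ) < n := by exact_mod_cast hn
  have he0 : 0 ≤ e := he ▸ by positivity
  have hq2 : 1 / (q : ℝ) ≤ 1 / 2 := one_div_le_one_div_of_le (by norm_num) hq'
  have hslope := slope_gt hq hβ hs hfix
  rw [hfix] at hslope
  have hSl : 0 < (classAfter q s - β⁻¹) / s := by linarith
  obtain ⟨C, hCJ, i, hCi, hCη, hdrift, hdriftA, hunif, hunifA⟩ := hz
  set τ : ℝ := (C.card : ℝ) / n with hτ
  have hητ : η ≤ τ := by rw [hτ, le_div_iff₀ hn']; exact hCη.le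
  have huniv : 0 < (Finset.univ : Finset (Fin n)).card := by simpa using hn
  have hxτ := hdrift.abs_div_le hβ0 huniv
  rw [Finset.inter_eq_right.2 hCJ, Finset.card_univ, Fintype.card_fin, ← hτ, he] at hxτ
  have hcontr := slope_mul_abs_sub_le hβ0 hs.1 hη hητ he0 hxτ (hfix ▸ hx.1.1)
  rw [hfix] at hcontr
  have hτs : (1 - 1 / q) * |τ - s| ≤ (1 - 1 / q) / ((classAfter q s - β⁻¹) / s) *
      (ρ + e / (1 - Real.exp (-(β * η)))) := by
    rw [div_mul_eq_mul_div, le_div_iff₀ hSl, mul_assoc]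
    exact mul_le_mul_of_nonneg_left (by linarith) (by linarith)
  have hi := hunif.abs_sub_classAfter_le hCi huniv
  simp only [Finset.univ_inter, Finset.card_univ, Fintype.card_fin, ← hτ, he] at hi
  refine ⟨i, ⟨?_, fun j hj => ?_⟩, fun k => ?_⟩
  · have h1 := abs_sub_le (cntFrac z i) (classAfter q τ) (classAfter q s)
    have h2 : classAfter q τ - classAfter q s = (1 - 1 / q) * (τ - s) := by
      rw [classAfter, classAfter]; ring
    rw [h2, abs_mul, abs_of_nonneg (by linarith : 0 ≤ 1 - 1 / (q : ℝ))] at h1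
    have h3 : |cntFrac z i - classAfter q τ| ≤ e := hi
    linarith
  · have h0 := hunif.abs_sub_le hCi hj huniv
    simp only [Finset.univ_inter, Finset.card_univ, Fintype.card_fin, ← hτ, he] at h0
    rw [one_sub_classAfter_div hq]
    have h1 := abs_sub_le (cntFrac z j) ((1 - τ) / q) ((1 - s) / q)
    have h2 : (1 - τ) / q - (1 - s) / q = -(1 / q * (τ - s)) := by ring
    rw [h2, abs_neg, abs_mul, abs_of_nonneg (by positivity : 0 ≤ 1 / (q : ℝ))] at h1
    have h3 : |cntFrac z j - (1 - τ) / q| ≤ e := h0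
    have h4 : 1 / q * |τ - s| ≤ (1 - 1 / q) * |τ - s| :=
      mul_le_mul_of_nonneg_right (by linarith) (abs_nonneg _)
    linarith
  · have hAn : 0 < lam * n := by positivity
    have hAk' : (0 : ℝ) < (A k).card := hAn.trans_le (hA k)
    have hAk : 0 < (A k).card := by exact_mod_cast hAk'
    have herr : Real.sqrt (K * n) / (A k).card ≤ e * lam⁻¹ := by
      rw [← he, ← div_eq_mul_inv, div_div]
      exact div_le_div_of_nonneg_left (Real.sqrt_nonneg _) (by positivity)
        (by rw [mul_comm]; exact hA k)
    have hk := ((hunifA k).abs_sub_classAfter_le hCi hAk).trans herr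
    have hkτ := ((hdriftA k).abs_div_le hβ0 hAk).trans herr
    rw [Finset.inter_assoc, Finset.inter_eq_right.2 hCJ, ← hτ] at hkτ
    set τk : ℝ := ((A k ∩ C).card : ℝ) / (A k).card
    set xk : ℝ := ((A k ∩ spinClass x J).card : ℝ) / (A k).card
    have hxk : |cntFrac x J - xk| ≤ ρ := hx.2 k
    set D := 1 - Real.exp (-(β * τ)) with hD
    have hD0 : 0 ≤ D := (one_sub_exp_neg_pos (mul_pos hβ0 (hη.trans_le hητ))).le
    have hD1 : D ≤ 1 := by rw [hD]; linarith [Real.exp_pos (-(β * τ))]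
    have hττk : |τ - τk| ≤ ρ + e * (1 + lam⁻¹) := by
      have h1 : τ - τk = (τ - cntFrac x J * D) + (cntFrac x J - xk) * D - (τk - xk * D) := by ring
      have h2 : |(cntFrac x J - xk) * D| ≤ ρ := by
        rw [abs_mul, abs_of_nonneg hD0]
        exact (mul_le_of_le_one_right (abs_nonneg _) hD1).trans hxk
      have h3 : |τ - cntFrac x J * D| ≤ e := hxτ
      have h4 := abs_le.1 h2
      have h5 := abs_le.1 h3
      have h6 := abs_le.1 hkτ
      rw [h1, abs_le]
      constructor <;> linarith
    have h1 : cntFrac z i - ((A k ∩ spinClass z i).card : ℝ) / (A k).card =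
        (cntFrac z i - classAfter q τ) + (1 - 1 / q) * (τ - τk) -
          (((A k ∩ spinClass z i).card : ℝ) / (A k).card - classAfter q τk) := by
      rw [classAfter, classAfter]; ring
    have h2 : |(1 - 1 / (q : ℝ)) * (τ - τk)| ≤ (1 - 1 / q) * (ρ + e * (1 + lam⁻¹)) := by
      rw [abs_mul, abs_of_nonneg (by linarith : 0 ≤ 1 - 1 / (q : ℝ))]
      exact mul_le_mul_of_nonneg_left hττk (by linarith)
    have h3 : |cntFrac z i - classAfter q τ| ≤ e := hi
    have h4 := abs_le.1 h2
    have h5 := abs_le.1 h3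
    have h6 := abs_le.1 hk
    rw [h1, abs_le]
    constructor <;> linarith

end Contraction

section Assembly

variable {n q : ℕ} {β : ℝ}

lemma swStep_nonneg (hβ : 0 < β) (σ τ : Conf n q) : 0 ≤ swStep n q β σ τ := by
  have h : 0 ≤ 1 - Real.exp (-(β / n)) := by
    have : Real.exp (-(β / n)) ≤ 1 := Real.exp_le_one_iff.2 (neg_nonpos.2 (by positivity))
    linarith
  refine Finset.sum_nonneg fun E _ => mul_nonneg (by positivity) ?_
  split_ifs <;> positivity

lemma exists_radius_fixing {c d u v : ℝ} (hc0 : 0 ≤ c) (hc : c < 1) (hd0 : 0 ≤ d) (hd : d < 1)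
    (hu : 0 < u) (hv : 0 < v) {κ : ℝ} (hκ : 0 < κ) :
    ∃ r, 0 < r ∧ c * (r + κ * u) + κ ≤ r ∧ d * (r + κ * v) + κ * v ≤ r := by
  have hc' : 0 < 1 - c := by linarith
  have hd' : 0 < 1 - d := by linarith
  refine ⟨(c * κ * u + κ) / (1 - c) + (d * κ * v + κ * v) / (1 - d), by positivity, ?_, ?_⟩
  · have h1 : (1 - c) * ((c * κ * u + κ) / (1 - c)) = c * κ * u + κ := by field_simp
    have h2 : 0 ≤ (1 - c) * ((d * κ * v + κ * v) / (1 - d)) := by positivity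
    linarith
  · have h1 : (1 - d) * ((d * κ * v + κ * v) / (1 - d)) = d * κ * v + κ * v := by field_simp
    have h2 : 0 ≤ (1 - d) * ((c * κ * u + κ) / (1 - c)) := by positivity
    linarith

/-- One Swendsen–Wang step preserves near-majority balance with probability at least `1 - ε`. -/
theorem exists_sum_swStep_good_ge (hq : 2 ≤ q) (hβ : (q : ℝ) < β) {lam ε : ℝ} (hlam : 0 < lam)
    (hε : 0 < ε) :
    ∃ r : ℝ, 0 < r ∧ ∃ N : ℕ, ∀ n : ℕ, N ≤ n → ∀ A : Fin q → Finset (Fin n),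
      (∀ k, lam * n ≤ (A k).card) → ∀ x : Conf n q,
      (linf (alphaVec x) (mVec q β) ≤ r / Real.sqrt n ∧
        ∀ k, |alpha1 x - alpha1In x (A k)| ≤ r / Real.sqrt n) →
      1 - ε ≤ ∑ z, swStep n q β x z *
        if linf (alphaVec z) (mVec q β) ≤ r / Real.sqrt n ∧
          ∀ k, |alpha1 z - alpha1In z (A k)| ≤ r / Real.sqrt n then 1 else 0 := by
  have hq' : (2 : ℝ) ≤ q := by exact_mod_cast hq
  have hβ0 : 0 < β := by linarith
  obtain ⟨s, hs, hfix⟩ := exists_classOfGiant_eq_classAfter hq hβ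
  have hslope := slope_gt hq hβ hs hfix
  have hab := classOfGiant_lt hβ0 hs.1
  have hβa := inv_lt_classOfGiant hβ0 hs.1
  rw [hfix] at hslope hab hβa
  have hm : mVec q β = kappaVec q (classAfter q s) := by
    rw [mVec, aFix_eq_classAfter hq hβ hs hfix]
  rw [hm]
  have hb := one_sub_classAfter_div hq s
  set a := classAfter q s with ha
  have hba : (1 - s) / q = a - s := by
    rw [ha, classAfter]
    field_simp
    ring
  rw [hba] at hb
  have hx0 : 1 < β * ((a + β⁻¹) / 2) := by
    have : β * β⁻¹ = 1 := mul_inv_cancel₀ hβ0.ne'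
    nlinarith
  have hq2 : 1 / (q : ℝ) ≤ 1 / 2 := one_div_le_one_div_of_le (by norm_num) hq'
  have hq0 : 0 < 1 / (q : ℝ) := by positivity
  have hSl : 0 < (a - β⁻¹) / s := by linarith
  have hρ' : β * ((a - s + β⁻¹) / 2) < 1 := by
    have : β * β⁻¹ = 1 := mul_inv_cancel₀ hβ0.ne'
    nlinarith
  obtain ⟨η, hη, K, hK, N, hN⟩ := sum_swStep_typicalStep_ge (q := q) (by omega) hβ0 hx0 hρ' hε
  have hD := one_sub_exp_neg_pos (mul_pos hβ0 hη)
  obtain ⟨r, hr, hr1, hr2⟩ := exists_radius_fixing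
    (c := (1 - 1 / q) / ((a - β⁻¹) / s)) (d := 1 - 1 / q) (u := (1 - Real.exp (-(β * η)))⁻¹)
    (v := 1 + lam⁻¹) (div_nonneg (by linarith) hSl.le) ((div_lt_one hSl).2 hslope)
    (by linarith) (by linarith) (by positivity) (by positivity) (Real.sqrt_pos.2 hK)
  have hsmall : ∀ᶠ n : ℕ in Filter.atTop,
      ∀ w ∈ ({(a - β⁻¹) / 2, (β⁻¹ - (a - s)) / 2, s / 3} : Finset ℝ), r / Real.sqrt n < w := by
    have hlim : Filter.Tendsto (fun n : ℕ => r / Real.sqrt n) Filter.atTop (nhds 0) :=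
      Filter.Tendsto.const_div_atTop
        (Real.tendsto_sqrt_atTop.comp tendsto_natCast_atTop_atTop) r
    rw [Finset.eventually_all]
    intro w hw
    refine hlim.eventually_lt_const ?_
    have := hs.1
    simp only [Finset.mem_insert, Finset.mem_singleton] at hw
    rcases hw with rfl | rfl | rfl <;> linarith
  obtain ⟨N', hN'⟩ := Filter.eventually_atTop.1 hsmall
  refine ⟨r, hr, max (max N N') 1, fun n hn A hA x hx => ?_⟩
  have hn0 : 0 < n := by omega
  have hn' : (0 : ℝ) < n := by exact_mod_cast hn0
  have hsq : 0 < Real.sqrt n := Real.sqrt_pos.2 hn'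
  set ρ := r / Real.sqrt n with hρdef
  have hρ1 := hN' n (by omega) ((a - β⁻¹) / 2) (by simp)
  have hρ2 := hN' n (by omega) ((β⁻¹ - (a - s)) / 2) (by simp)
  have hρ3 := hN' n (by omega) (s / 3) (by simp)
  have hgap : (1 - a) / ((q : ℝ) - 1) + ρ < a - ρ := by rw [hb]; linarith [hs.1]
  simp only [← exists_balancedMajority_iff hn0 (by omega) hgap] at hx ⊢
  obtain ⟨J, hJ⟩ := hx
  have he : Real.sqrt (K * n) / n = Real.sqrt K / Real.sqrt n := by
    rw [Real.sqrt_mul hK.le, mul_div_assoc, Real.sqrt_div_self', mul_one_div]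
  refine (hN n (by omega) x J ?_ ?_ A).trans (Finset.sum_le_sum fun z _ =>
    mul_le_mul_of_nonneg_left ?_ (swStep_nonneg hβ0 x z))
  · rw [← le_div_iff₀ hn']
    have := (abs_le.1 hJ.1.1).1
    change -ρ ≤ ((spinClass x J).card : ℝ) / n - a at this
    linarith
  · intro j hj
    have := (abs_le.1 (hJ.1.2 j hj)).2
    rw [hb] at this
    change ((spinClass x j).card : ℝ) / n - (a - s) ≤ ρ at this
    rw [mul_assoc]
    refine mul_le_mul_of_nonneg_left ?_ hβ0.le
    rw [← div_le_iff₀ hn']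
    linarith
  · split_ifs with h1 h2
    · rfl
    · refine absurd (hJ.of_typicalStep hq hβ hs hfix hn0 hlam hη hA he ?_ ?_ h1) h2
      · have := div_le_div_of_nonneg_right hr1 hsq.le
        refine Eq.trans_le ?_ this
        rw [hρdef]
        ring
      · have := div_le_div_of_nonneg_right hr2 hsq.le
        refine Eq.trans_le ?_ this
        rw [hρdef]
        ring
    · exact zero_le_one
    · rfl

end Assembly

/-- Fact 6.2: the "good" event `P(r)` (both configurations within
`r/√n` of `m`, and all in-class dominant-spin fractions within `r/√n` of the global one)
is preserved by one independent SW step from each copy with probability at least `δ`,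
for a suitable constant `r = r(δ)`. -/
theorem sw_preserves_good_event (q : ℕ) (hq : 2 ≤ q) (β : ℝ) (hβ : (q : ℝ) < β)
    (lam : ℝ) (hlam : lam ∈ Set.Ioo (0 : ℝ) 1) (δ : ℝ) (hδ : δ ∈ Set.Ioo (0 : ℝ) 1) :
    ∃ r : ℝ, 0 < r ∧ ∃ N : ℕ, ∀ n : ℕ, N ≤ n →
      ∀ P : Fin q → Finset (Fin n), IsLamPartition lam P →
      ∀ x y : Conf n q,
        (linf (alphaVec x) (mVec q β) ≤ r / Real.sqrt n ∧
          linf (alphaVec y) (mVec q β) ≤ r / Real.sqrt n ∧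
          (∀ k : Fin q, |alpha1 x - alpha1In x (P k)| ≤ r / Real.sqrt n) ∧
          (∀ k : Fin q, |alpha1 y - alpha1In y (P k)| ≤ r / Real.sqrt n)) →
        δ ≤ ∑ z : Conf n q × Conf n q,
          (if linf (alphaVec z.1) (mVec q β) ≤ r / Real.sqrt n ∧
              linf (alphaVec z.2) (mVec q β) ≤ r / Real.sqrt n ∧
              (∀ k : Fin q, |alpha1 z.1 - alpha1In z.1 (P k)| ≤ r / Real.sqrt n) ∧
              (∀ k : Fin q, |alpha1 z.2 - alpha1In z.2 (P k)| ≤ r / Real.sqrt n)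
            then swStep n q β x z.1 * swStep n q β y z.2 else 0) := by
  obtain ⟨r, hr, N, hN⟩ := exists_sum_swStep_good_ge hq hβ hlam.1
    (show 0 < (1 - δ) / 2 by linarith [hδ.2])
  refine ⟨r, hr, N, fun n hn P hP x y h => ?_⟩
  have hx := hN n hn P hP.2 x ⟨h.1, h.2.2.1⟩
  have hy := hN n hn P hP.2 y ⟨h.2.1, h.2.2.2⟩
  have hδ1 := hδ.1
  have hpos : 0 ≤ 1 - (1 - δ) / 2 := by linarith
  calc δ ≤ (1 - (1 - δ) / 2) * (1 - (1 - δ) / 2) := by nlinarith [sq_nonneg (1 - δ)]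
    _ ≤ _ := mul_le_mul hx hy hpos (hpos.trans hx)
    _ = _ := by
      rw [Finset.sum_mul_sum, ← Finset.univ_product_univ, Finset.sum_product]
      refine Finset.sum_congr rfl fun z _ => Finset.sum_congr rfl fun w _ => ?_
      rw [mul_mul_mul_comm, ite_zero_mul_ite_zero, mul_one, mul_ite, mul_one, mul_zero]
      exact if_congr (by tauto) rfl rfl
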